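/- Let k be a field and let Λ, Γ and Σ be finite dimensional k-algebras. If the pair (M, N) defines a singular equivalence of Morita type with level l between Λ and Γ, and the pair (X, Y) defines a singular equivalence of Morita type with level w between Γ and Σ, then the pair (M ⊗_Γ X, Y ⊗_Γ N) defines a singular equivalence of Morita type with level l + w between Λ and Σ. In particular, being singularly equivalent of Morita type with level is a transitive relation on finite dimensional k-algebras. -/

import Mathlib

open TensorProduct MulOpposite

section BimodInfra

variable (k : Type) [Field k]

/-- The `k`-algebra endomorphism ring homomorphism sending a `k`-linear endomorphism `f` of `Y`
to `X ⊗ f`. -/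
noncomputable def lTensorAlgHom (X Y : Type) [AddCommGroup X] [Module k X] [AddCommGroup Y] [Module k Y] :
    Module.End k Y →ₐ[k] Module.End k (X ⊗[k] Y) where
  toFun f := LinearMap.lTensor X f
  map_one' := LinearMap.lTensor_id X Y
  map_mul' f g := LinearMap.lTensor_comp X f g
  map_zero' := LinearMap.lTensor_zero X
  map_add' f g := LinearMap.lTensor_add X f g
  commutes' c := by
    ext y
    simp [Module.algebraMap_end_apply, TensorProduct.smul_tmul', TensorProduct.tmul_smul]

/-- Same for `f ⊗ Y`. -/
noncomputable def rTensorAlgHom (X Y : Type) [AddCommGroup X] [Module k X] [AddCommGroup Y] [Module k Y] :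
    Module.End k X →ₐ[k] Module.End k (X ⊗[k] Y) where
  toFun f := LinearMap.rTensor Y f
  map_one' := LinearMap.rTensor_id Y X
  map_mul' f g := LinearMap.rTensor_comp Y f g
  map_zero' := LinearMap.rTensor_zero Y
  map_add' f g := LinearMap.rTensor_add Y f g
  commutes' c := by
    ext x
    simp [Module.algebraMap_end_apply, TensorProduct.smul_tmul', TensorProduct.tmul_smul]

variable (A B C : Type) [Ring A] [Ring B] [Ring C] [Algebra k A] [Algebra k B] [Algebra k C]
variable (X : Type) [AddCommGroup X] [Module k X] [Module (A ⊗[k] Bᵐᵒᵖ) X]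
  [IsScalarTower k (A ⊗[k] Bᵐᵒᵖ) X]
variable (Y : Type) [AddCommGroup Y] [Module k Y] [Module (B ⊗[k] Cᵐᵒᵖ) Y]
  [IsScalarTower k (B ⊗[k] Cᵐᵒᵖ) Y]

/-- The action of `A ⊗ Cᵐᵒᵖ` on `X ⊗[k] Y`: `A` acts through the left tensor factor of `X`,
`Cᵐᵒᵖ` acts through the right tensor factor of `Y`. -/
noncomputable def outerAction : (A ⊗[k] Cᵐᵒᵖ) →ₐ[k] Module.End k (X ⊗[k] Y) :=
  Algebra.TensorProduct.lift
    ((rTensorAlgHom k X Y).comp ((Algebra.lsmul k k X).comp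
      (Algebra.TensorProduct.includeLeft : A →ₐ[k] A ⊗[k] Bᵐᵒᵖ)))
    ((lTensorAlgHom k X Y).comp ((Algebra.lsmul k k Y).comp
      (Algebra.TensorProduct.includeRight : Cᵐᵒᵖ →ₐ[k] B ⊗[k] Cᵐᵒᵖ)))
    (fun a c => by
      show Commute (LinearMap.rTensor Y _) (LinearMap.lTensor X _)
      unfold Commute SemiconjBy
      ext x y
      simp [LinearMap.rTensor, LinearMap.lTensor, TensorProduct.map_tmul])

/-- The `(A ⊗ Cᵐᵒᵖ)`-module structure on `X ⊗[k] Y`. -/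
noncomputable def outerModule : Module (A ⊗[k] Cᵐᵒᵖ) (X ⊗[k] Y) :=
  Module.compHom _ (outerAction k A B C X Y).toRingHom

/-- The submodule of `X ⊗[k] Y` generated by the `B`-balancing relations
`(x·b) ⊗ y - x ⊗ (b·y)`. -/
noncomputable def balancedSub : @Submodule (A ⊗[k] Cᵐᵒᵖ) (X ⊗[k] Y) _ _
    (outerModule k A B C X Y) :=
  letI := outerModule k A B C X Y
  Submodule.span (A ⊗[k] Cᵐᵒᵖ)
    {z | ∃ (x : X) (b : B) (y : Y),
      z = ((((1 : A) ⊗ₜ[k] (op b)) • x) ⊗ₜ[k] y) - (x ⊗ₜ[k] ((b ⊗ₜ[k] (1 : Cᵐᵒᵖ)) • y))}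

/-- The balanced tensor product `X ⊗_B Y` of the `(A,B)`-bimodule `X` and the
`(B,C)`-bimodule `Y`, an `(A,C)`-bimodule, i.e. a left `A ⊗[k] Cᵐᵒᵖ`-module. -/
noncomputable def BTensor : Type :=
  letI := outerModule k A B C X Y
  (X ⊗[k] Y) ⧸ balancedSub k A B C X Y

noncomputable instance BTensor.instAddCommGroup : AddCommGroup (BTensor k A B C X Y) :=
  letI := outerModule k A B C X Y
  inferInstanceAs (AddCommGroup ((X ⊗[k] Y) ⧸ balancedSub k A B C X Y))

noncomputable instance BTensor.instModule : Module (A ⊗[k] Cᵐᵒᵖ) (BTensor k A B C X Y) :=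
  letI := outerModule k A B C X Y
  inferInstanceAs (Module (A ⊗[k] Cᵐᵒᵖ) ((X ⊗[k] Y) ⧸ balancedSub k A B C X Y))

noncomputable instance BTensor.instModuleK : Module k (BTensor k A B C X Y) :=
  Module.compHom _ (algebraMap k (A ⊗[k] Cᵐᵒᵖ))

noncomputable instance BTensor.instTower :
    IsScalarTower k (A ⊗[k] Cᵐᵒᵖ) (BTensor k A B C X Y) :=
  ⟨fun c s z => by
    have h : (c • s) = algebraMap k (A ⊗[k] Cᵐᵒᵖ) c * s := Algebra.smul_def c s
    rw [h, mul_smul]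
    rfl⟩

end BimodInfra

section Restrict

variable (k : Type) [Field k] (A B : Type) [Ring A] [Ring B] [Algebra k A] [Algebra k B]
variable (X : Type) [AddCommGroup X] [Module (A ⊗[k] Bᵐᵒᵖ) X]

/-- The left `A`-module structure on an `(A,B)`-bimodule. -/
noncomputable def leftRestrict : Module A X :=
  Module.compHom X (Algebra.TensorProduct.includeLeft : A →ₐ[k] A ⊗[k] Bᵐᵒᵖ).toRingHom

/-- The right `B`-module (left `Bᵐᵒᵖ`-module) structure on an `(A,B)`-bimodule. -/
noncomputable def rightRestrict : Module Bᵐᵒᵖ X :=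
  Module.compHom X (Algebra.TensorProduct.includeRight : Bᵐᵒᵖ →ₐ[k] A ⊗[k] Bᵐᵒᵖ).toRingHom

/-- The canonical `k`-module structure on a module over the `k`-algebra `S`. -/
def modK (S : Type) [Ring S] [Algebra k S] (Z : Type) [AddCommGroup Z] [Module S Z] :
    Module k Z :=
  Module.compHom Z (algebraMap k S)

/-- The compatibility of `modK` with the `S`-action. -/
def towerK (S : Type) [Ring S] [Algebra k S] (Z : Type) [AddCommGroup Z] [Module S Z] :
    letI := modK k S Z; IsScalarTower k S Z := by
  letI := modK k S Z
  exact ⟨fun c s z => by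
    have h : (c • s) = algebraMap k S c * s := Algebra.smul_def c s
    rw [h, mul_smul]
    rfl⟩

end Restrict

section Regular

variable (k : Type) [Field k] (A : Type) [Ring A] [Algebra k A]

/-- The regular `(A,A)`-bimodule structure on `A`: `(a ⊗ bᵒᵖ) • x = a * x * b`. -/
noncomputable def regularBimodule : Module (A ⊗[k] Aᵐᵒᵖ) A :=
  TensorProduct.Algebra.module

end Regular

/-- `p : P → M` is a projective cover: `P` is finitely generated projective, `p` is
surjective and `ker p` is superfluous in `P`. -/
def IsProjCover (S : Type) [Ring S] {P M : Type} [AddCommGroup P] [Module S P]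
    [AddCommGroup M] [Module S M] (p : P →ₗ[S] M) : Prop :=
  Module.Finite S P ∧ Module.Projective S P ∧ Function.Surjective p ∧
    ∀ L : Submodule S P, L ⊔ LinearMap.ker p = ⊤ → L = ⊤

/-- `Z` is a syzygy of `M`: the kernel of a projective cover of `M`. -/
def IsSyzygyOf (S : Type) [Ring S] (Z M : ModuleCat.{0} S) : Prop :=
  ∃ (P : ModuleCat.{0} S) (p : P →ₗ[S] M),
    IsProjCover S p ∧ Nonempty (Z ≃ₗ[S] LinearMap.ker p)

/-- `Z` is an `n`-th syzygy of `M` (with respect to projective covers). -/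
def IsNthSyzygyOf (S : Type) [Ring S] : ℕ → ModuleCat.{0} S → ModuleCat.{0} S → Prop
  | 0, Z, M => Nonempty (Z ≃ₗ[S] M)
  | n + 1, Z, M => ∃ W : ModuleCat.{0} S, IsNthSyzygyOf S n W M ∧ IsSyzygyOf S Z W

/-- `X` is periodic of period `p`: `Ω^p(X) ≅ X` and `p` is the least positive
integer with this property. -/
def IsPeriodicWithPeriod (S : Type) [Ring S] (X : ModuleCat.{0} S) (p : ℕ) : Prop :=
  0 < p ∧ (∃ Z, IsNthSyzygyOf S p Z X ∧ Nonempty (Z ≃ₗ[S] X)) ∧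
    ∀ q : ℕ, 0 < q → (∃ Z, IsNthSyzygyOf S q Z X ∧ Nonempty (Z ≃ₗ[S] X)) → p ≤ q

/-- `A` and `B` are stably isomorphic: `A ⊕ P ≅ B ⊕ Q` for some finitely generated
projective modules `P` and `Q`. -/
def StablyIso (S : Type) [Ring S] (A B : Type) [AddCommGroup A] [Module S A]
    [AddCommGroup B] [Module S B] : Prop :=
  ∃ P Q : ModuleCat.{0} S,
    Module.Finite S P ∧ Module.Projective S P ∧
    Module.Finite S Q ∧ Module.Projective S Q ∧
    Nonempty ((A × P) ≃ₗ[S] (B × Q))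

section SingEq

variable (k : Type) [Field k]
variable (Λ Γ : Type) [Ring Λ] [Ring Γ] [Algebra k Λ] [Algebra k Γ]
variable (M : Type) [AddCommGroup M] [Module k M] [Module (Λ ⊗[k] Γᵐᵒᵖ) M]
  [IsScalarTower k (Λ ⊗[k] Γᵐᵒᵖ) M]
variable (N : Type) [AddCommGroup N] [Module k N] [Module (Γ ⊗[k] Λᵐᵒᵖ) N]
  [IsScalarTower k (Γ ⊗[k] Λᵐᵒᵖ) N]

/-- The pair of bimodules `(M, N)` defines a singular equivalence of Morita type with
level `l`:  `M`, `N` are finitely generated projective on either side, `M ⊗_Γ N` is stably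
isomorphic to `Ω_{Λᵉ}^l(Λ)` and `N ⊗_Λ M` is stably isomorphic to `Ω_{Γᵉ}^l(Γ)`. -/
noncomputable def DefinesSingEqOfLevel (l : ℕ) : Prop :=
  (letI := leftRestrict k Λ Γ M; Module.Finite Λ M ∧ Module.Projective Λ M) ∧
  (letI := rightRestrict k Λ Γ M; Module.Finite Γᵐᵒᵖ M ∧ Module.Projective Γᵐᵒᵖ M) ∧
  (letI := leftRestrict k Γ Λ N; Module.Finite Γ N ∧ Module.Projective Γ N) ∧
  (letI := rightRestrict k Γ Λ N; Module.Finite Λᵐᵒᵖ N ∧ Module.Projective Λᵐᵒᵖ N) ∧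
  (letI := regularBimodule k Λ;
    ∃ Z : ModuleCat.{0} (Λ ⊗[k] Λᵐᵒᵖ),
      IsNthSyzygyOf (Λ ⊗[k] Λᵐᵒᵖ) l Z (ModuleCat.of (Λ ⊗[k] Λᵐᵒᵖ) Λ) ∧
      StablyIso (Λ ⊗[k] Λᵐᵒᵖ) (BTensor k Λ Γ Λ M N) Z) ∧
  (letI := regularBimodule k Γ;
    ∃ Z : ModuleCat.{0} (Γ ⊗[k] Γᵐᵒᵖ),
      IsNthSyzygyOf (Γ ⊗[k] Γᵐᵒᵖ) l Z (ModuleCat.of (Γ ⊗[k] Γᵐᵒᵖ) Γ) ∧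
      StablyIso (Γ ⊗[k] Γᵐᵒᵖ) (BTensor k Γ Λ Γ N M) Z)

end SingEq

/-- A witness that `Λ` and `Γ` are singularly equivalent of Morita type with level. -/
structure SingEqMoritaLevel (k Λ Γ : Type) [Field k] [Ring Λ] [Ring Γ]
    [Algebra k Λ] [Algebra k Γ] : Type 1 where
  M : Type
  N : Type
  [acgM : AddCommGroup M] [modkM : Module k M] [modM : Module (Λ ⊗[k] Γᵐᵒᵖ) M]
  [towM : IsScalarTower k (Λ ⊗[k] Γᵐᵒᵖ) M]
  [acgN : AddCommGroup N] [modkN : Module k N] [modN : Module (Γ ⊗[k] Λᵐᵒᵖ) N]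
  [towN : IsScalarTower k (Γ ⊗[k] Λᵐᵒᵖ) N]
  l : ℕ
  defines : DefinesSingEqOfLevel k Λ Γ M N l

/-- `M` is an eventually periodic module: some syzygy `Ω^n(M)` is nonzero and periodic. -/
def IsEventuallyPeriodicModule (S : Type) [Ring S] (M : ModuleCat.{0} S) : Prop :=
  ∃ (n : ℕ) (Z : ModuleCat.{0} S), IsNthSyzygyOf S n Z M ∧ Nontrivial Z ∧
    ∃ p : ℕ, 0 < p ∧ ∃ W, IsNthSyzygyOf S p W Z ∧ Nonempty (W ≃ₗ[S] Z)

/-- `Λ` is an eventually periodic algebra: it is eventually periodic as a module over its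
enveloping algebra `Λ ⊗[k] Λᵐᵒᵖ`. -/
noncomputable def IsEventuallyPeriodicAlgebra (k Λ : Type) [Field k] [Ring Λ]
    [Algebra k Λ] : Prop :=
  letI := regularBimodule k Λ
  IsEventuallyPeriodicModule (Λ ⊗[k] Λᵐᵒᵖ) (ModuleCat.of (Λ ⊗[k] Λᵐᵒᵖ) Λ)

section Syzygies

variable {S : Type} [Ring S]

/-- **Schanuel's lemma**. -/
theorem schanuel {K P K' P' A : Type} [AddCommGroup K] [Module S K] [AddCommGroup P] [Module S P]
    [AddCommGroup K'] [Module S K'] [AddCommGroup P'] [Module S P'] [AddCommGroup A] [Module S A]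
    [Module.Projective S P] [Module.Projective S P']
    {i : K →ₗ[S] P} {p : P →ₗ[S] A} {i' : K' →ₗ[S] P'} {p' : P' →ₗ[S] A}
    (hi : Function.Injective i) (hip : Function.Exact i p) (hp : Function.Surjective p)
    (hi' : Function.Injective i') (hip' : Function.Exact i' p') (hp' : Function.Surjective p') :
    Nonempty ((K × P') ≃ₗ[S] (K' × P)) := by
  obtain ⟨s, hs⟩ := Module.projective_lifting_property p p' hp
  obtain ⟨t, ht⟩ := Module.projective_lifting_property p' p hp'
  have hs' (y : P') : p (s y) = p' y := LinearMap.congr_fun hs y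
  have ht' (x : P) : p' (t x) = p x := LinearMap.congr_fun ht x
  let f : (K × P') →ₗ[S] (P × P') := (i.coprod s).prod (LinearMap.snd S K P')
  let g : (K' × P) →ₗ[S] (P × P') := (LinearMap.snd S K' P).prod (i'.coprod t)
  have hf : Function.Injective f := by
    rintro ⟨a, b⟩ ⟨c, d⟩ h
    obtain ⟨h₁, rfl⟩ : i a + s b = i c + s d ∧ b = d := by simpa [f] using h
    rw [hi (add_right_cancel h₁)]
  have hg : Function.Injective g := by
    rintro ⟨a, b⟩ ⟨c, d⟩ h
    obtain ⟨rfl, h₁⟩ : b = d ∧ i' a + t b = i' c + t d := by simpa [g] using h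
    rw [hi' (add_right_cancel h₁)]
  have hfg : LinearMap.range f = LinearMap.range g := by
    ext ⟨x, y⟩
    trans p x = p' y
    · constructor
      · rintro ⟨⟨a, b⟩, h⟩
        obtain ⟨rfl, rfl⟩ : i a + s b = x ∧ b = y := by simpa [f] using h
        rw [map_add, hip.apply_apply_eq_zero, hs', zero_add]
      · intro h
        obtain ⟨a, ha⟩ := (hip (x - s y)).1 (by rw [map_sub, hs', h, sub_self])
        exact ⟨(a, y), by simp [f, ha]⟩
    · constructor
      · intro h
        obtain ⟨a, ha⟩ := (hip' (y - t x)).1 (by rw [map_sub, ht', h, sub_self])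
        exact ⟨(a, x), by simp [g, ha]⟩
      · rintro ⟨⟨a, b⟩, h⟩
        obtain ⟨rfl, rfl⟩ : b = x ∧ i' a + t b = y := by simpa [g] using h
        rw [map_add, hip'.apply_apply_eq_zero, ht', zero_add]
  exact ⟨(LinearEquiv.ofInjective f hf).trans
    ((LinearEquiv.ofEq _ _ hfg).trans (LinearEquiv.ofInjective g hg).symm)⟩

theorem StablyIso.of_equiv {A B : Type} [AddCommGroup A] [Module S A] [AddCommGroup B]
    [Module S B] (e : A ≃ₗ[S] B) : StablyIso S A B :=
  ⟨ModuleCat.of S PUnit, ModuleCat.of S PUnit, inferInstanceAs (Module.Finite S PUnit),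
    inferInstanceAs (Module.Projective S PUnit), inferInstanceAs (Module.Finite S PUnit),
    inferInstanceAs (Module.Projective S PUnit), ⟨e.prodCongr (LinearEquiv.refl S _)⟩⟩

theorem StablyIso.trans {A B C : Type} [AddCommGroup A] [Module S A] [AddCommGroup B]
    [Module S B] [AddCommGroup C] [Module S C] (h₁ : StablyIso S A B) (h₂ : StablyIso S B C) :
    StablyIso S A C := by
  obtain ⟨P, Q, _, _, _, _, ⟨e⟩⟩ := h₁
  obtain ⟨P', Q', _, _, _, _, ⟨e'⟩⟩ := h₂
  refine ⟨ModuleCat.of S (P × P'), ModuleCat.of S (Q' × Q), inferInstanceAs (Module.Finite S (P × P')),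
    inferInstanceAs (Module.Projective S (P × P')), inferInstanceAs (Module.Finite S (Q' × Q)),
    inferInstanceAs (Module.Projective S (Q' × Q)), ⟨?_⟩⟩
  exact (LinearEquiv.prodAssoc S A P P').symm ≪≫ₗ e.prodCongr (LinearEquiv.refl S P') ≪≫ₗ
    LinearEquiv.prodAssoc S B Q P' ≪≫ₗ
    (LinearEquiv.refl S B).prodCongr (LinearEquiv.prodComm S Q P') ≪≫ₗ
    (LinearEquiv.prodAssoc S B P' Q).symm ≪≫ₗ e'.prodCongr (LinearEquiv.refl S Q) ≪≫ₗ
    LinearEquiv.prodAssoc S C Q' Q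

/-- `K` is the kernel of a surjection from a finitely generated projective module onto `A`. -/
def IsProjKernelOf (S : Type) [Ring S] (K A : ModuleCat.{0} S) : Prop :=
  ∃ (P : ModuleCat.{0} S) (i : K →ₗ[S] P) (p : P →ₗ[S] A),
    Module.Finite S P ∧ Module.Projective S P ∧
      Function.Injective i ∧ Function.Exact i p ∧ Function.Surjective p

/-- `K` is an `n`-th kernel in a resolution of `A` by finitely generated projective modules,
not necessarily minimal. -/
def IsNthProjKernelOf (S : Type) [Ring S] : ℕ → ModuleCat.{0} S → ModuleCat.{0} S → Prop
  | 0, K, A => Nonempty (K ≃ₗ[S] A)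
  | n + 1, K, A => ∃ W : ModuleCat.{0} S, IsNthProjKernelOf S n W A ∧ IsProjKernelOf S K W

theorem IsSyzygyOf.isProjKernelOf {K A : ModuleCat.{0} S} (h : IsSyzygyOf S K A) :
    IsProjKernelOf S K A := by
  obtain ⟨P, p, ⟨hfin, hproj, hsurj, -⟩, ⟨e⟩⟩ := h
  refine ⟨P, (LinearMap.ker p).subtype ∘ₗ e.toLinearMap, p, hfin, hproj,
    (Submodule.injective_subtype _).comp e.injective, fun x => ⟨fun hx => ?_, ?_⟩, hsurj⟩
  · exact ⟨e.symm ⟨x, hx⟩, by simp⟩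
  · rintro ⟨z, rfl⟩
    exact (e z).2

theorem IsNthSyzygyOf.isNthProjKernelOf {A : ModuleCat.{0} S} {n : ℕ} {K : ModuleCat.{0} S}
    (h : IsNthSyzygyOf S n K A) : IsNthProjKernelOf S n K A := by
  induction n generalizing K with
  | zero => exact h
  | succ n ih =>
    obtain ⟨W, hW, hK⟩ := h
    exact ⟨W, ih hW, hK.isProjKernelOf⟩

theorem IsProjKernelOf.stablyIso {K A K' A' : ModuleCat.{0} S} (h : IsProjKernelOf S K A)
    (h' : IsProjKernelOf S K' A') (e : StablyIso S A A') : StablyIso S K K' := by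
  obtain ⟨P, i, p, _, _, hi, hip, hp⟩ := h
  obtain ⟨P', i', p', _, _, hi', hip', hp'⟩ := h'
  obtain ⟨Q, Q', _, _, _, _, ⟨e⟩⟩ := e
  have key : Nonempty ((K × (P' × Q')) ≃ₗ[S] (K' × (P × Q))) := by
    refine schanuel (A := A' × Q') (i := LinearMap.inl S P Q ∘ₗ i)
      (p := e.toLinearMap ∘ₗ p.prodMap LinearMap.id)
      (i' := LinearMap.inl S P' Q' ∘ₗ i') (p' := p'.prodMap LinearMap.id) ?_ ?_ ?_ ?_ ?_ ?_
    · exact LinearMap.inl_injective.comp hi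
    · rintro ⟨x, q⟩
      have := hip x
      simp only [LinearMap.comp_apply, LinearEquiv.coe_coe, map_eq_zero_iff e e.injective]
      simpa [Set.mem_range, eq_comm (a := q)] using fun _ => this
    · exact e.surjective.comp (hp.prodMap Function.surjective_id)
    · exact LinearMap.inl_injective.comp hi'
    · rintro ⟨x, q⟩
      have := hip' x
      simpa [Set.mem_range, eq_comm (a := q)] using fun _ => this
    · exact hp'.prodMap Function.surjective_id
  exact ⟨ModuleCat.of S (P' × Q'), ModuleCat.of S (P × Q),
    inferInstanceAs (Module.Finite S (P' × Q')), inferInstanceAs (Module.Projective S (P' × Q')),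
    inferInstanceAs (Module.Finite S (P × Q)), inferInstanceAs (Module.Projective S (P × Q)), key⟩

theorem IsNthProjKernelOf.stablyIso {A A' : ModuleCat.{0} S} (e : StablyIso S A A') {n : ℕ}
    {K K' : ModuleCat.{0} S} (h : IsNthProjKernelOf S n K A) (h' : IsNthProjKernelOf S n K' A') :
    StablyIso S K K' := by
  induction n generalizing K K' with
  | zero =>
    obtain ⟨f⟩ := h
    obtain ⟨f'⟩ := h'
    exact (StablyIso.of_equiv f).trans (e.trans (StablyIso.of_equiv f'.symm))
  | succ n ih =>
    obtain ⟨W, hW, hK⟩ := h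
    obtain ⟨W', hW', hK'⟩ := h'
    exact hK.stablyIso hK' (ih hW hW')

theorem IsNthSyzygyOf.of_equiv {A Z Z' : ModuleCat.{0} S} {n : ℕ} (e : Z ≃ₗ[S] Z')
    (h : IsNthSyzygyOf S n Z A) : IsNthSyzygyOf S n Z' A := by
  cases n with
  | zero => exact h.map e.symm.trans
  | succ n =>
    obtain ⟨W, hW, P, p, hp, he⟩ := h
    exact ⟨W, hW, P, p, hp, he.map e.symm.trans⟩

theorem IsNthSyzygyOf.add {A B : ModuleCat.{0} S} {m : ℕ} (h : IsNthSyzygyOf S m B A) {n : ℕ}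
    {C : ModuleCat.{0} S} (h' : IsNthSyzygyOf S n C B) : IsNthSyzygyOf S (m + n) C A := by
  induction n generalizing C with
  | zero =>
    obtain ⟨f⟩ := h'
    exact h.of_equiv f.symm
  | succ n ih =>
    obtain ⟨W, hW, hC⟩ := h'
    exact ⟨W, ih hW, hC⟩

/-- Every finitely generated module over an artinian ring has a projective cover. -/
theorem exists_isProjCover [IsArtinianRing S] (A : ModuleCat.{0} S) [Module.Finite S A] :
    ∃ (P : ModuleCat.{0} S) (p : P →ₗ[S] A), IsProjCover S p := by
  classical
  obtain ⟨n, f, hf⟩ := Module.Finite.exists_fin' S A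
  let good : Set (Submodule S (Fin n → S)) :=
    {L | Module.Projective S L ∧ Function.Surjective (f.domRestrict L)}
  have htop : (⊤ : Submodule S (Fin n → S)) ∈ good :=
    ⟨Module.Projective.of_equiv (Submodule.topEquiv (R := S) (M := Fin n → S)).symm,
      fun a => (hf a).imp' (fun x => ⟨x, trivial⟩) fun _ h => h⟩
  obtain ⟨P, ⟨hproj, hsurj⟩, hmin⟩ := WellFounded.has_min
    (wellFounded_lt (α := Submodule S (Fin n → S))) good ⟨⊤, htop⟩
  refine ⟨ModuleCat.of S P, f.domRestrict P, inferInstanceAs (Module.Finite S P), hproj, hsurj,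
    fun L (hL : L ⊔ LinearMap.ker (f.domRestrict P) = ⊤) => ?_⟩
  change Submodule S P at L
  set p := f.domRestrict P
  have hpL : Function.Surjective (p ∘ₗ L.subtype) := by
    intro a
    obtain ⟨x, rfl⟩ := hsurj a
    obtain ⟨y, hy, z, hz, rfl⟩ := Submodule.mem_sup.1 (hL ▸ Submodule.mem_top : x ∈ L ⊔ _)
    exact ⟨⟨y, hy⟩, by simp [LinearMap.mem_ker.1 hz]⟩
  obtain ⟨s, hs⟩ := Module.projective_lifting_property (p ∘ₗ L.subtype) p hpL
  let g : Module.End S P := L.subtype ∘ₗ s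
  have hg (x : P) : p (g x) = p x := LinearMap.congr_fun hs x
  have hgn (m : ℕ) (x : P) : p ((g ^ m) x) = p x := by
    induction m with
    | zero => simp
    | succ m ih => rw [pow_succ', Module.End.mul_apply, hg, ih]
  obtain ⟨m, hm, hm1⟩ := (g.eventually_isCompl_ker_pow_range_pow.and
    (Filter.eventually_ge_atTop 1)).exists
  have hR : Module.Projective S (LinearMap.range (g ^ m)) :=
    Module.Projective.of_split (LinearMap.range (g ^ m)).subtype
      (Submodule.projectionOnto _ _ hm.symm)
      (Submodule.projectionOnto_comp_subtype hm.symm)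
  have hmem : (LinearMap.range (g ^ m)).map P.subtype ∈ good := by
    refine ⟨Module.Projective.of_equiv
      (Submodule.equivSubtypeMap P (LinearMap.range (g ^ m))), fun a => ?_⟩
    obtain ⟨x, rfl⟩ := hsurj a
    exact ⟨⟨(g ^ m) x, Submodule.mem_map.2 ⟨(g ^ m) x, ⟨x, rfl⟩, rfl⟩⟩, hgn m x⟩
  have hle : (LinearMap.range (g ^ m)).map P.subtype ≤ P := Submodule.map_subtype_le _ _
  have heq := eq_of_le_of_not_lt hle (hmin _ hmem)
  refine eq_top_iff.2 fun x _ => ?_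
  obtain ⟨y, ⟨z, rfl⟩, hy⟩ := Submodule.mem_map.1 (heq.ge x.2)
  obtain rfl : (g ^ m) z = x := Subtype.ext hy
  obtain ⟨j, rfl⟩ := Nat.exists_eq_add_of_le' hm1
  rw [pow_succ', Module.End.mul_apply]
  exact (s _).2

theorem exists_isNthSyzygyOf [IsArtinianRing S] (A : ModuleCat.{0} S) [Module.Finite S A] (n : ℕ) :
    ∃ Z : ModuleCat.{0} S, IsNthSyzygyOf S n Z A ∧ Module.Finite S Z := by
  induction n with
  | zero => exact ⟨A, ⟨LinearEquiv.refl S A⟩, inferInstance⟩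
  | succ n ih =>
    obtain ⟨W, hW, _⟩ := ih
    obtain ⟨P, p, hp⟩ := exists_isProjCover W
    have := hp.1
    exact ⟨ModuleCat.of S (LinearMap.ker p), ⟨W, hW, P, p, hp, ⟨LinearEquiv.refl S _⟩⟩,
      inferInstanceAs (Module.Finite S (LinearMap.ker p))⟩

theorem IsNthSyzygyOf.finite [IsArtinianRing S] {A : ModuleCat.{0} S} [Module.Finite S A] {n : ℕ}
    {Z : ModuleCat.{0} S} (h : IsNthSyzygyOf S n Z A) : Module.Finite S Z := by
  cases n with
  | zero => exact h.elim fun e => Module.Finite.equiv e.symm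
  | succ n =>
    obtain ⟨W, -, P, p, ⟨_, -⟩, ⟨e⟩⟩ := h
    exact Module.Finite.equiv e.symm

end Syzygies

section Functors

open CategoryTheory

variable {S T U : Type} [Ring S] [Ring T] [Ring U]

/-- An exact functor of module categories preserving finitely generated projective modules. -/
structure IsExactProj (F : ModuleCat.{0} S ⥤ ModuleCat.{0} T) : Prop where
  injective {A B : ModuleCat.{0} S} (f : A ⟶ B) :
    Function.Injective f.hom → Function.Injective (F.map f).hom
  exact {A B C : ModuleCat.{0} S} (f : A ⟶ B) (g : B ⟶ C) :
    Function.Exact f.hom g.hom → Function.Exact (F.map f).hom (F.map g).hom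
  surjective {A B : ModuleCat.{0} S} (f : A ⟶ B) :
    Function.Surjective f.hom → Function.Surjective (F.map f).hom
  proj (P : ModuleCat.{0} S) : Module.Finite S P → Module.Projective S P →
    Module.Finite T (F.obj P) ∧ Module.Projective T (F.obj P)

theorem IsExactProj.comp {F : ModuleCat.{0} S ⥤ ModuleCat.{0} T}
    {G : ModuleCat.{0} T ⥤ ModuleCat.{0} U} (hF : IsExactProj F) (hG : IsExactProj G) :
    IsExactProj (F ⋙ G) where
  injective f h := hG.injective _ (hF.injective f h)
  exact f g h := hG.exact _ _ (hF.exact f g h)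
  surjective f h := hG.surjective _ (hF.surjective f h)
  proj P h₁ h₂ := (hF.proj P h₁ h₂).elim (hG.proj _)

variable {F : ModuleCat.{0} S ⥤ ModuleCat.{0} T}

/-- A functor transports linear equivalences. -/
theorem CategoryTheory.Functor.nonempty_linearEquiv (F : ModuleCat.{0} S ⥤ ModuleCat.{0} T)
    {A B : ModuleCat.{0} S} (e : A ≃ₗ[S] B) : Nonempty (F.obj A ≃ₗ[T] F.obj B) :=
  ⟨(F.mapIso (LinearEquiv.toModuleIso (X₁ := A) (X₂ := B) e)).toLinearEquiv⟩

theorem IsExactProj.isProjKernelOf (hF : IsExactProj F) {K A : ModuleCat.{0} S}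
    (h : IsProjKernelOf S K A) : IsProjKernelOf T (F.obj K) (F.obj A) := by
  obtain ⟨P, i, p, hfin, hproj, hi, hip, hp⟩ := h
  exact ⟨F.obj P, (F.map (ModuleCat.ofHom i)).hom, (F.map (ModuleCat.ofHom p)).hom,
    (hF.proj P hfin hproj).1, (hF.proj P hfin hproj).2, hF.injective _ hi, hF.exact _ _ hip,
    hF.surjective _ hp⟩

theorem IsExactProj.isNthProjKernelOf (hF : IsExactProj F) {A : ModuleCat.{0} S} {n : ℕ}
    {K : ModuleCat.{0} S} (h : IsNthProjKernelOf S n K A) :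
    IsNthProjKernelOf T n (F.obj K) (F.obj A) := by
  induction n generalizing K with
  | zero => exact h.elim F.nonempty_linearEquiv
  | succ n ih =>
    obtain ⟨W, hW, hK⟩ := h
    exact ⟨F.obj W, ih hW, hF.isProjKernelOf hK⟩

/-- An additive functor preserves products of modules. -/
theorem CategoryTheory.Functor.nonempty_prod_linearEquiv
    (F : ModuleCat.{0} S ⥤ ModuleCat.{0} T) [F.Additive] (A B : ModuleCat.{0} S) :
    Nonempty (F.obj (ModuleCat.of S (A × B)) ≃ₗ[T] (F.obj A × F.obj B)) := by
  let inl : A ⟶ ModuleCat.of S (A × B) := ModuleCat.ofHom (LinearMap.inl S A B)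
  let inr : B ⟶ ModuleCat.of S (A × B) := ModuleCat.ofHom (LinearMap.inr S A B)
  let fst : ModuleCat.of S (A × B) ⟶ A := ModuleCat.ofHom (LinearMap.fst S A B)
  let snd : ModuleCat.of S (A × B) ⟶ B := ModuleCat.ofHom (LinearMap.snd S A B)
  have h₁ : inl ≫ fst = 𝟙 A := rfl
  have h₂ : inr ≫ snd = 𝟙 B := rfl
  have h₃ : inl ≫ snd = 0 := rfl
  have h₄ : inr ≫ fst = 0 := rfl
  have h₅ : fst ≫ inl + snd ≫ inr = 𝟙 _ := by
    refine ModuleCat.hom_ext (LinearMap.ext fun x => ?_)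
    exact Prod.ext (add_zero (fst.hom x)) (zero_add (snd.hom x))
  replace h₁ := congrArg F.map h₁
  replace h₂ := congrArg F.map h₂
  replace h₃ := congrArg F.map h₃
  replace h₄ := congrArg F.map h₄
  replace h₅ := congrArg F.map h₅
  simp only [F.map_comp, F.map_add, F.map_id, F.map_zero] at h₁ h₂ h₃ h₄ h₅
  have e₁ (x) : (F.map fst).hom ((F.map inl).hom x) = x := ConcreteCategory.congr_hom h₁ x
  have e₂ (x) : (F.map snd).hom ((F.map inr).hom x) = x := ConcreteCategory.congr_hom h₂ x
  have e₃ (x) : (F.map snd).hom ((F.map inl).hom x) = 0 := ConcreteCategory.congr_hom h₃ x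
  have e₄ (x) : (F.map fst).hom ((F.map inr).hom x) = 0 := ConcreteCategory.congr_hom h₄ x
  have e₅ (x) : (F.map inl).hom ((F.map fst).hom x) + (F.map inr).hom ((F.map snd).hom x) = x :=
    ConcreteCategory.congr_hom h₅ x
  refine ⟨LinearEquiv.ofLinearMap ((F.map fst).hom.prod (F.map snd).hom)
    ((F.map inl).hom.coprod (F.map inr).hom) ?_ ?_⟩
  · ext x <;> simp [e₁, e₂, e₃, e₄]
  · ext x
    exact e₅ x

theorem IsExactProj.stablyIso [F.Additive] (hF : IsExactProj F) {A B : ModuleCat.{0} S}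
    (h : StablyIso S A B) : StablyIso T (F.obj A) (F.obj B) := by
  obtain ⟨P, Q, hP, hP', hQ, hQ', ⟨e⟩⟩ := h
  obtain ⟨eA⟩ := F.nonempty_prod_linearEquiv A P
  obtain ⟨eB⟩ := F.nonempty_prod_linearEquiv B Q
  obtain ⟨e'⟩ := F.nonempty_linearEquiv (A := ModuleCat.of S (A × P))
    (B := ModuleCat.of S (B × Q)) e
  exact ⟨F.obj P, F.obj Q, (hF.proj P hP hP').1, (hF.proj P hP hP').2, (hF.proj Q hQ hQ').1,
    (hF.proj Q hQ hQ').2, ⟨eA.symm ≪≫ₗ e' ≪≫ₗ eB⟩⟩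

/-- A finitely generated projective module has a finite dual basis. -/
theorem exists_dualBasis (S P : Type) [Ring S] [AddCommGroup P] [Module S P] [Module.Finite S P]
    [Module.Projective S P] :
    ∃ (n : ℕ) (b : Fin n → P) (φ : Fin n → P →ₗ[S] S), ∀ x, ∑ j, φ j x • b j = x := by
  obtain ⟨n, f, g, -, -, h⟩ := Module.Finite.exists_comp_eq_id_of_projective S P
  refine ⟨n, fun j => f (Pi.single j 1), fun j => LinearMap.proj j ∘ₗ g, fun x => ?_⟩
  conv_rhs => rw [← LinearMap.id_apply (R := S) x, ← h, LinearMap.comp_apply,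
    ← Finset.univ_sum_single (g x), map_sum]
  refine Finset.sum_congr rfl fun j _ => ?_
  rw [LinearMap.comp_apply, LinearMap.proj_apply, ← map_smul, ← Pi.single_smul, smul_eq_mul,
    mul_one]

/-- A module through which the identity factors as a finite sum of maps over a finitely
generated projective module is finitely generated projective. -/
theorem finite_projective_of_sum_comp_eq {M Q : Type} [AddCommGroup M] [Module S M]
    [AddCommGroup Q] [Module S Q] (hfin : Module.Finite S Q) (hproj : Module.Projective S Q)
    {n : ℕ} (r : Fin n → Q →ₗ[S] M) (s : Fin n → M →ₗ[S] Q) (h : ∀ x, ∑ j, r j (s j x) = x) :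
    Module.Finite S M ∧ Module.Projective S M := by
  let ρ : (Fin n → Q) →ₗ[S] M := ∑ j, r j ∘ₗ LinearMap.proj j
  have hρ : ρ ∘ₗ LinearMap.pi s = LinearMap.id := by
    ext x
    simpa [ρ] using h x
  have : Module.Projective S (Fin n → Q) := Module.Projective.of_equiv
    (DFinsupp.linearEquivFunOnFintype (R := S) (M := fun _ : Fin n => Q))
  exact ⟨Module.Finite.of_surjective ρ fun x => ⟨LinearMap.pi s x, LinearMap.congr_fun hρ x⟩,
    Module.Projective.of_split _ ρ hρ⟩

/-- An additive functor preserves finitely generated projective modules as soon as its value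
at the regular module is finitely generated projective. -/
theorem CategoryTheory.Functor.finite_projective_obj [F.Additive]
    (hfin : Module.Finite T (F.obj (ModuleCat.of S S)))
    (hproj : Module.Projective T (F.obj (ModuleCat.of S S)))
    (P : ModuleCat.{0} S) [Module.Finite S P] [Module.Projective S P] :
    Module.Finite T (F.obj P) ∧ Module.Projective T (F.obj P) := by
  obtain ⟨n, b, φ, h⟩ := exists_dualBasis S P
  let r (j : Fin n) : ModuleCat.of S S ⟶ P := ModuleCat.ofHom (LinearMap.toSpanSingleton S P (b j))
  let s (j : Fin n) : P ⟶ ModuleCat.of S S := ModuleCat.ofHom (φ j)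
  have hrs : ∑ j, s j ≫ r j = 𝟙 P := by
    ext x
    simpa [r, s] using h x
  refine finite_projective_of_sum_comp_eq hfin hproj (fun j => (F.map (r j)).hom)
    (fun j => (F.map (s j)).hom) fun x => ?_
  have := ConcreteCategory.congr_hom (congrArg F.map hrs) x
  simpa [F.map_sum] using this

end Functors

section BTensorAPI

variable {k : Type} [Field k]
variable {A B C D : Type} [Ring A] [Ring B] [Ring C] [Ring D]
  [Algebra k A] [Algebra k B] [Algebra k C] [Algebra k D]
variable {X : Type} [AddCommGroup X] [Module k X] [Module (A ⊗[k] Bᵐᵒᵖ) X]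
  [IsScalarTower k (A ⊗[k] Bᵐᵒᵖ) X]
variable {Y : Type} [AddCommGroup Y] [Module k Y] [Module (B ⊗[k] Cᵐᵒᵖ) Y]
  [IsScalarTower k (B ⊗[k] Cᵐᵒᵖ) Y]
variable {W : Type} [AddCommGroup W] [Module k W] [Module (C ⊗[k] Dᵐᵒᵖ) W]
  [IsScalarTower k (C ⊗[k] Dᵐᵒᵖ) W]

/-- An action of `A ⊗ Bᵐᵒᵖ` splits into the actions of both factors. -/
theorem tmul_smul_eq {V : Type} [AddCommGroup V] [Module (A ⊗[k] Bᵐᵒᵖ) V] (a : A) (b : Bᵐᵒᵖ)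
    (x : V) : (a ⊗ₜ[k] b) • x = (a ⊗ₜ[k] (1 : Bᵐᵒᵖ)) • ((1 : A) ⊗ₜ[k] b) • x := by
  rw [smul_smul, Algebra.TensorProduct.tmul_mul_tmul, mul_one, one_mul]

/-- The actions of both factors of `A ⊗ Bᵐᵒᵖ` commute. -/
theorem one_tmul_smul_tmul_one_smul {V : Type} [AddCommGroup V] [Module (A ⊗[k] Bᵐᵒᵖ) V]
    (a : A) (b : Bᵐᵒᵖ) (x : V) :
    ((1 : A) ⊗ₜ[k] b) • (a ⊗ₜ[k] (1 : Bᵐᵒᵖ)) • x =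
      (a ⊗ₜ[k] (1 : Bᵐᵒᵖ)) • ((1 : A) ⊗ₜ[k] b) • x := by
  rw [← tmul_smul_eq, smul_smul, Algebra.TensorProduct.tmul_mul_tmul, mul_one, one_mul]

/-- An additive map commuting with the actions of both factors is `A ⊗ Bᵐᵒᵖ`-linear. -/
theorem map_smul_of_map_tmul_smul {V V' : Type} [AddCommGroup V] [Module (A ⊗[k] Bᵐᵒᵖ) V]
    [AddCommGroup V'] [Module (A ⊗[k] Bᵐᵒᵖ) V'] (f : V →+ V')
    (h₁ : ∀ (a : A) x, f ((a ⊗ₜ[k] (1 : Bᵐᵒᵖ)) • x) = (a ⊗ₜ[k] (1 : Bᵐᵒᵖ)) • f x)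
    (h₂ : ∀ (b : Bᵐᵒᵖ) x, f (((1 : A) ⊗ₜ[k] b) • x) = ((1 : A) ⊗ₜ[k] b) • f x)
    (u : A ⊗[k] Bᵐᵒᵖ) (x : V) : f (u • x) = u • f x := by
  induction u using TensorProduct.induction_on with
  | zero =>
    exact (congrArg f (zero_smul (A ⊗[k] Bᵐᵒᵖ) x)).trans
      ((map_zero f).trans (zero_smul (A ⊗[k] Bᵐᵒᵖ) (f x)).symm)
  | tmul a b => rw [tmul_smul_eq, h₁, h₂, ← tmul_smul_eq]
  | add u v hu hv => rw [add_smul, add_smul, map_add, hu, hv]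

theorem smul_eq_tmul_one_smul {V : Type} [AddCommGroup V] [Module k V] [Module (A ⊗[k] Bᵐᵒᵖ) V]
    [IsScalarTower k (A ⊗[k] Bᵐᵒᵖ) V] (c : k) (x : V) :
    c • x = ((c • (1 : A)) ⊗ₜ[k] (1 : Bᵐᵒᵖ)) • x := by
  rw [← TensorProduct.smul_tmul', smul_assoc, ← Algebra.TensorProduct.one_def, one_smul]

theorem smul_eq_one_tmul_smul {V : Type} [AddCommGroup V] [Module k V] [Module (A ⊗[k] Bᵐᵒᵖ) V]
    [IsScalarTower k (A ⊗[k] Bᵐᵒᵖ) V] (c : k) (x : V) :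
    c • x = ((1 : A) ⊗ₜ[k] op (c • (1 : B))) • x := by
  rw [op_smul, TensorProduct.tmul_smul, smul_assoc, op_one, ← Algebra.TensorProduct.one_def,
    one_smul]

namespace BTensor

variable (k A B C) in
/-- The class of `x ⊗ y` in `X ⊗_B Y`. -/
noncomputable def mk (x : X) (y : Y) : BTensor k A B C X Y :=
  letI := outerModule k A B C X Y
  (balancedSub k A B C X Y).mkQ (x ⊗ₜ[k] y)

variable (k A B C X Y) in
/-- The additive quotient map from the tensor product over `k`. -/
noncomputable def proj : (X ⊗[k] Y) →+ BTensor k A B C X Y :=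
  letI := outerModule k A B C X Y
  (balancedSub k A B C X Y).mkQ.toAddMonoidHom

theorem proj_surjective : Function.Surjective (proj k A B C X Y) :=
  letI := outerModule k A B C X Y
  (balancedSub k A B C X Y).mkQ_surjective

theorem proj_tmul (x : X) (y : Y) : proj k A B C X Y (x ⊗ₜ y) = mk k A B C x y := rfl

theorem outer_tmul_smul_tmul (a : A) (c : Cᵐᵒᵖ) (x : X) (y : Y) :
    letI := outerModule k A B C X Y
    (a ⊗ₜ[k] c) • (x ⊗ₜ[k] y) =
      ((a ⊗ₜ[k] (1 : Bᵐᵒᵖ)) • x) ⊗ₜ[k] (((1 : B) ⊗ₜ[k] c) • y) := by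
  change outerAction k A B C X Y (a ⊗ₜ[k] c) (x ⊗ₜ[k] y) = _
  simp [outerAction, rTensorAlgHom, lTensorAlgHom]

theorem tmul_smul_mk (a : A) (c : Cᵐᵒᵖ) (x : X) (y : Y) :
    (a ⊗ₜ[k] c) • mk k A B C x y =
      mk k A B C ((a ⊗ₜ[k] (1 : Bᵐᵒᵖ)) • x) (((1 : B) ⊗ₜ[k] c) • y) := by
  let := outerModule k A B C X Y
  rw [mk, mk, ← outer_tmul_smul_tmul]
  exact ((balancedSub k A B C X Y).mkQ.map_smul _ _).symm

@[simp]
theorem tmul_one_smul_mk (a : A) (x : X) (y : Y) :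
    (a ⊗ₜ[k] (1 : Cᵐᵒᵖ)) • mk k A B C x y = mk k A B C ((a ⊗ₜ[k] (1 : Bᵐᵒᵖ)) • x) y := by
  rw [tmul_smul_mk, ← Algebra.TensorProduct.one_def, one_smul]

@[simp]
theorem one_tmul_smul_mk (c : Cᵐᵒᵖ) (x : X) (y : Y) :
    ((1 : A) ⊗ₜ[k] c) • mk k A B C x y = mk k A B C x (((1 : B) ⊗ₜ[k] c) • y) := by
  rw [tmul_smul_mk, ← Algebra.TensorProduct.one_def, one_smul]

theorem mk_balanced (x : X) (b : B) (y : Y) :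
    mk k A B C (((1 : A) ⊗ₜ[k] op b) • x) y = mk k A B C x ((b ⊗ₜ[k] (1 : Cᵐᵒᵖ)) • y) := by
  let := outerModule k A B C X Y
  exact (Submodule.Quotient.eq _).2 (Submodule.subset_span ⟨x, b, y, rfl⟩)

theorem mk_add_left (x x' : X) (y : Y) :
    mk k A B C (x + x') y = mk k A B C x y + mk k A B C x' y := by
  rw [← proj_tmul, add_tmul, map_add]
  rfl

theorem mk_add_right (x : X) (y y' : Y) :
    mk k A B C x (y + y') = mk k A B C x y + mk k A B C x y' := by
  rw [← proj_tmul, tmul_add, map_add]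
  rfl

variable (k A B C X) in
/-- `mk` as an additive map in its left argument. -/
noncomputable def mkLeft (y : Y) : X →+ BTensor k A B C X Y :=
  AddMonoidHom.mk' (fun x => mk k A B C x y) fun _ _ => mk_add_left _ _ _

variable (k A B C Y) in
/-- `mk` as an additive map in its right argument. -/
noncomputable def mkRight (x : X) : Y →+ BTensor k A B C X Y :=
  AddMonoidHom.mk' (fun y => mk k A B C x y) fun _ _ => mk_add_right _ _ _

theorem mk_sum_left {ι : Type} (s : Finset ι) (f : ι → X) (y : Y) :
    mk k A B C (∑ j ∈ s, f j) y = ∑ j ∈ s, mk k A B C (f j) y :=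
  map_sum (mkLeft k A B C X y) f s

theorem mk_sum_right {ι : Type} (s : Finset ι) (x : X) (f : ι → Y) :
    mk k A B C x (∑ j ∈ s, f j) = ∑ j ∈ s, mk k A B C x (f j) :=
  map_sum (mkRight k A B C Y x) f s

@[elab_as_elim]
theorem induction_on {p : BTensor k A B C X Y → Prop} (z : BTensor k A B C X Y)
    (mk : ∀ x y, p (mk k A B C x y)) (add : ∀ z z', p z → p z' → p (z + z')) : p z := by
  obtain ⟨t, rfl⟩ := proj_surjective z
  induction t using TensorProduct.induction_on with
  | zero =>
    have h : proj k A B C X Y 0 = BTensor.mk k A B C 0 0 := by rw [← proj_tmul, zero_tmul]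
    exact (congrArg p h).mpr (mk 0 0)
  | tmul x y => exact mk x y
  | add s t hs ht => rw [map_add]; exact add _ _ hs ht

theorem addHom_ext {Z : Type} [AddCommGroup Z] {f g : BTensor k A B C X Y →+ Z}
    (h : ∀ x y, f (mk k A B C x y) = g (mk k A B C x y)) : f = g := by
  ext z
  induction z using induction_on with
  | mk x y => exact h x y
  | add z z' hz hz' => rw [map_add, map_add, hz, hz']

section Lift

variable {Z : Type} [AddCommGroup Z] (f : X → Y → Z)
  (hl : ∀ x x' y, f (x + x') y = f x y + f x' y)
  (hr : ∀ x y y', f x (y + y') = f x y + f x y')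
  (hb : ∀ x (b : B) y, f (((1 : A) ⊗ₜ[k] op b) • x) y = f x ((b ⊗ₜ[k] (1 : Cᵐᵒᵖ)) • y))

/-- The additive map on `X ⊗_k Y` given by a `B`-balanced biadditive map. -/
noncomputable def preLift : (X ⊗[k] Y) →+ Z :=
  TensorProduct.liftAddHom
    (AddMonoidHom.mk' (fun x => AddMonoidHom.mk' (f x) (hr x)) fun x x' => by
      ext y
      exact hl x x' y)
    fun c x y => by
      change f (c • x) y = f x (c • y)
      rw [smul_eq_one_tmul_smul (A := A) (B := B) c x, hb,
        ← smul_eq_tmul_one_smul (A := B) (B := C)]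

/-- The additive map on `X ⊗_B Y` given by a `B`-balanced biadditive map. -/
noncomputable def liftAdd : BTensor k A B C X Y →+ Z :=
  letI := outerModule k A B C X Y
  QuotientAddGroup.lift (balancedSub k A B C X Y).toAddSubgroup (preLift f hl hr hb) <| by
    intro z (hz : z ∈ balancedSub k A B C X Y)
    suffices ∀ u : A ⊗[k] Cᵐᵒᵖ, preLift f hl hr hb (u • z) = 0 by simpa using this 1
    induction hz using Submodule.span_induction with
    | mem z hz =>
      obtain ⟨x, b, y, rfl⟩ := hz
      intro u
      induction u using TensorProduct.induction_on with
      | zero =>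
        exact (congrArg (preLift f hl hr hb) (zero_smul (A ⊗[k] Cᵐᵒᵖ) _)).trans (map_zero _)
      | tmul a c =>
        rw [smul_sub, outer_tmul_smul_tmul, outer_tmul_smul_tmul, map_sub, sub_eq_zero,
          one_tmul_smul_tmul_one_smul, ← one_tmul_smul_tmul_one_smul]
        exact hb _ _ _
      | add u v hu hv => rw [add_smul, map_add, hu, hv, add_zero]
    | zero => simp
    | add z z' _ _ hz hz' => intro u; rw [smul_add, map_add, hz, hz', add_zero]
    | smul v z _ hz => intro u; rw [smul_smul, hz]

@[simp]
theorem liftAdd_mk (x : X) (y : Y) : liftAdd f hl hr hb (mk k A B C x y) = f x y := rfl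

end Lift

/-- The linear map on `X ⊗_B Y` given by a `B`-balanced biadditive map compatible with the
outer actions. -/
noncomputable def lift {Z : Type} [AddCommGroup Z] [Module (A ⊗[k] Cᵐᵒᵖ) Z] (f : X → Y → Z)
    (hl : ∀ x x' y, f (x + x') y = f x y + f x' y)
    (hr : ∀ x y y', f x (y + y') = f x y + f x y')
    (hb : ∀ x (b : B) y, f (((1 : A) ⊗ₜ[k] op b) • x) y = f x ((b ⊗ₜ[k] (1 : Cᵐᵒᵖ)) • y))
    (ha : ∀ (a : A) x y, f ((a ⊗ₜ[k] (1 : Bᵐᵒᵖ)) • x) y = (a ⊗ₜ[k] (1 : Cᵐᵒᵖ)) • f x y)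
    (hc : ∀ x (c : Cᵐᵒᵖ) y, f x (((1 : B) ⊗ₜ[k] c) • y) = ((1 : A) ⊗ₜ[k] c) • f x y) :
    BTensor k A B C X Y →ₗ[A ⊗[k] Cᵐᵒᵖ] Z where
  __ := liftAdd f hl hr hb
  map_smul' u z := by
    refine map_smul_of_map_tmul_smul (liftAdd f hl hr hb) (fun a z => ?_) (fun c z => ?_) u z
    · induction z using induction_on with
      | mk x y => simp [ha]
      | add z z' hz hz' => simp only [smul_add, map_add, hz, hz']
    · induction z using induction_on with
      | mk x y => simp [hc]
      | add z z' hz hz' => simp only [smul_add, map_add, hz, hz']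

section LiftMk

variable {Z : Type} [AddCommGroup Z] [Module (A ⊗[k] Cᵐᵒᵖ) Z]

@[simp]
theorem lift_mk (f : X → Y → Z) (hl hr hb ha hc) (x : X) (y : Y) :
    lift (k := k) (A := A) (B := B) (C := C) f hl hr hb ha hc (mk k A B C x y) = f x y := rfl

theorem hom_ext {f g : BTensor k A B C X Y →ₗ[A ⊗[k] Cᵐᵒᵖ] Z}
    (h : ∀ x y, f (mk k A B C x y) = g (mk k A B C x y)) : f = g :=
  LinearMap.toAddMonoidHom_injective (addHom_ext h)

end LiftMk

section Map

variable {X' : Type} [AddCommGroup X'] [Module k X'] [Module (A ⊗[k] Bᵐᵒᵖ) X']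
  [IsScalarTower k (A ⊗[k] Bᵐᵒᵖ) X']
variable {Y' : Type} [AddCommGroup Y'] [Module k Y'] [Module (B ⊗[k] Cᵐᵒᵖ) Y']
  [IsScalarTower k (B ⊗[k] Cᵐᵒᵖ) Y']

/-- Functoriality of the balanced tensor product. -/
noncomputable def map (f : X →ₗ[A ⊗[k] Bᵐᵒᵖ] X') (g : Y →ₗ[B ⊗[k] Cᵐᵒᵖ] Y') :
    BTensor k A B C X Y →ₗ[A ⊗[k] Cᵐᵒᵖ] BTensor k A B C X' Y' :=
  lift (fun x y => mk k A B C (f x) (g y)) (by simp [mk_add_left]) (by simp [mk_add_right])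
    (by simp [mk_balanced]) (by simp) (by simp)

@[simp]
theorem map_mk (f : X →ₗ[A ⊗[k] Bᵐᵒᵖ] X') (g : Y →ₗ[B ⊗[k] Cᵐᵒᵖ] Y') (x : X) (y : Y) :
    map f g (mk k A B C x y) = mk k A B C (f x) (g y) := rfl

/-- The balanced tensor product of linear equivalences. -/
noncomputable def congr (e : X ≃ₗ[A ⊗[k] Bᵐᵒᵖ] X') (e' : Y ≃ₗ[B ⊗[k] Cᵐᵒᵖ] Y') :
    BTensor k A B C X Y ≃ₗ[A ⊗[k] Cᵐᵒᵖ] BTensor k A B C X' Y' :=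
  LinearEquiv.ofLinearMap (map e.toLinearMap e'.toLinearMap)
    (map e.symm.toLinearMap e'.symm.toLinearMap)
    (hom_ext fun x y => by simp) (hom_ext fun x y => by simp)

end Map

/-- The map underlying the associativity of balanced tensor products. -/
noncomputable def assocHom :
    BTensor k A C D (BTensor k A B C X Y) W →ₗ[A ⊗[k] Dᵐᵒᵖ]
      BTensor k A B D X (BTensor k B C D Y W) :=
  lift (fun z w => liftAdd (fun x y => mk k A B D x (mk k B C D y w))
      (fun _ _ _ => mk_add_left _ _ _) (fun _ _ _ => by rw [mk_add_left, mk_add_right])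
      (fun _ _ _ => by rw [mk_balanced, tmul_one_smul_mk]) z)
    (fun _ _ _ => map_add _ _ _)
    (fun z w w' => by
      induction z using induction_on with
      | mk x y => simp [mk_add_right]
      | add z z' hz hz' => simp only [map_add, hz, hz']; abel)
    (fun z b w => by
      induction z using induction_on with
      | mk x y => simp [mk_balanced]
      | add z z' hz hz' => simp only [smul_add, map_add, hz, hz'])
    (fun a z w => by
      induction z using induction_on with
      | mk x y => simp
      | add z z' hz hz' => simp only [smul_add, map_add, hz, hz'])
    (fun z c w => by
      induction z using induction_on with
      | mk x y => simp
      | add z z' hz hz' => simp only [smul_add, map_add, hz, hz'])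

/-- The inverse of `assocHom`. -/
noncomputable def assocInv :
    BTensor k A B D X (BTensor k B C D Y W) →ₗ[A ⊗[k] Dᵐᵒᵖ]
      BTensor k A C D (BTensor k A B C X Y) W :=
  lift (fun x z => liftAdd (fun y w => mk k A C D (mk k A B C x y) w)
      (fun _ _ _ => by rw [mk_add_right, mk_add_left]) (fun _ _ _ => mk_add_right _ _ _)
      (fun _ _ _ => by rw [← mk_balanced, one_tmul_smul_mk]) z)
    (fun x x' z => by
      induction z using induction_on with
      | mk y w => simp [mk_add_left]
      | add z z' hz hz' => simp only [map_add, hz, hz']; abel)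
    (fun _ _ _ => map_add _ _ _)
    (fun x b z => by
      induction z using induction_on with
      | mk y w => simp [mk_balanced]
      | add z z' hz hz' => simp only [smul_add, map_add, hz, hz'])
    (fun a x z => by
      induction z using induction_on with
      | mk y w => simp
      | add z z' hz hz' => simp only [smul_add, map_add, hz, hz'])
    (fun x c z => by
      induction z using induction_on with
      | mk y w => simp
      | add z z' hz hz' => simp only [smul_add, map_add, hz, hz'])

variable (k A B C D X Y W) in
/-- Associativity of balanced tensor products. -/
noncomputable def assoc :
    BTensor k A C D (BTensor k A B C X Y) W ≃ₗ[A ⊗[k] Dᵐᵒᵖ]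
      BTensor k A B D X (BTensor k B C D Y W) :=
  LinearEquiv.ofLinearMap assocHom assocInv
    (hom_ext fun x z => by
      induction z using induction_on with
      | mk y w => rfl
      | add z z' hz hz' => rw [mk_add_right, map_add, map_add, hz, hz'])
    (hom_ext fun z w => by
      induction z using induction_on with
      | mk x y => rfl
      | add z z' hz hz' => rw [mk_add_left, map_add, map_add, hz, hz'])

end BTensor

end BTensorAPI

section Regular

variable {k : Type} [Field k] {B : Type} [Ring B] [Algebra k B]

theorem regularBimodule_smul (a b x : B) :
    letI := regularBimodule k B
    (a ⊗ₜ[k] op b) • x = a * x * b := by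
  let := regularBimodule k B
  exact (TensorProduct.Algebra.smul_def a (op b) x).trans (by simp [mul_assoc])

theorem regularBimodule_isScalarTower :
    letI := regularBimodule k B
    IsScalarTower k (B ⊗[k] Bᵐᵒᵖ) B := by
  let := regularBimodule k B
  refine ⟨fun c u x => ?_⟩
  induction u using TensorProduct.induction_on with
  | zero =>
    exact (congrArg (· • x) (smul_zero (A := B ⊗[k] Bᵐᵒᵖ) c)).trans
      ((zero_smul (B ⊗[k] Bᵐᵒᵖ) x).trans
        ((smul_zero c).symm.trans (congrArg (c • ·) (zero_smul (B ⊗[k] Bᵐᵒᵖ) x).symm)))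
  | tmul a b =>
    rw [TensorProduct.smul_tmul', ← op_unop b, regularBimodule_smul, regularBimodule_smul,
      smul_mul_assoc, smul_mul_assoc]
  | add u v hu hv => rw [smul_add, add_smul, add_smul, smul_add, hu, hv]

end Regular

section BTensorExact

variable {k : Type} [Field k]
variable {A B C : Type} [Ring A] [Ring B] [Ring C]
  [Algebra k A] [Algebra k B] [Algebra k C]
variable {X : Type} [AddCommGroup X] [Module k X] [Module (A ⊗[k] Bᵐᵒᵖ) X]
  [IsScalarTower k (A ⊗[k] Bᵐᵒᵖ) X]
variable {Y : Type} [AddCommGroup Y] [Module k Y] [Module (B ⊗[k] Cᵐᵒᵖ) Y]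
  [IsScalarTower k (B ⊗[k] Cᵐᵒᵖ) Y]

namespace BTensor

/-- The regular bimodule is a right unit for the balanced tensor product. -/
theorem nonempty_rightUnit :
    letI := regularBimodule k B
    haveI := regularBimodule_isScalarTower (k := k) (B := B)
    Nonempty (BTensor k A B B X B ≃ₗ[A ⊗[k] Bᵐᵒᵖ] X) := by
  let := regularBimodule k B
  have := regularBimodule_isScalarTower (k := k) (B := B)
  have hl (b y : B) : (b ⊗ₜ[k] (1 : Bᵐᵒᵖ)) • y = b * y := by
    rw [← op_one, regularBimodule_smul, mul_one]
  have hr (c : Bᵐᵒᵖ) (y : B) : ((1 : B) ⊗ₜ[k] c) • y = y * unop c := by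
    rw [← op_unop c, regularBimodule_smul, one_mul, unop_op]
  let f : BTensor k A B B X B →ₗ[A ⊗[k] Bᵐᵒᵖ] X :=
    lift (fun x b => ((1 : A) ⊗ₜ[k] op b) • x) (fun _ _ _ => smul_add _ _ _)
      (fun _ _ _ => by rw [op_add, tmul_add, add_smul])
      (fun _ _ _ => by
        rw [hl, smul_smul, Algebra.TensorProduct.tmul_mul_tmul, op_mul, one_mul])
      (fun _ _ _ => one_tmul_smul_tmul_one_smul _ _ _)
      (fun _ _ _ => by
        rw [hr, smul_smul, Algebra.TensorProduct.tmul_mul_tmul, op_mul, one_mul, op_unop])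
  refine ⟨LinearEquiv.ofBijective f ⟨Function.LeftInverse.injective
    (g := fun x => mk k A B B x 1) fun z => ?_, fun x => ⟨mk k A B B x 1, ?_⟩⟩⟩
  · induction z using induction_on with
    | mk x b =>
      change mk k A B B (((1 : A) ⊗ₜ[k] op b) • x) 1 = _
      rw [mk_balanced, hl, mul_one]
    | add z z' hz hz' => simp only [map_add, mk_add_left, hz, hz']
  · change ((1 : A) ⊗ₜ[k] op (1 : B)) • x = x
    rw [op_one, ← Algebra.TensorProduct.one_def, one_smul]

end BTensor

/-- A finite dual basis of an `(A,B)`-bimodule as a left `A`-module. -/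
theorem exists_leftDualBasis {V : Type} [AddCommGroup V] [Module (A ⊗[k] Bᵐᵒᵖ) V]
    (h : letI := leftRestrict k A B V; Module.Finite A V ∧ Module.Projective A V) :
    ∃ (n : ℕ) (b : Fin n → V) (φ : Fin n → V →+ A),
      (∀ j a x, φ j ((a ⊗ₜ[k] (1 : Bᵐᵒᵖ)) • x) = a * φ j x) ∧
      ∀ x, ∑ j, (φ j x ⊗ₜ[k] (1 : Bᵐᵒᵖ)) • b j = x := by
  let := leftRestrict k A B V
  obtain ⟨_, _⟩ := h
  obtain ⟨n, b, φ, hφ⟩ := exists_dualBasis A V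
  exact ⟨n, b, fun j => (φ j).toAddMonoidHom, fun j a x => (φ j).map_smul a x, hφ⟩

/-- A finite dual basis of an `(A,B)`-bimodule as a right `B`-module. -/
theorem exists_rightDualBasis {V : Type} [AddCommGroup V] [Module (A ⊗[k] Bᵐᵒᵖ) V]
    (h : letI := rightRestrict k A B V; Module.Finite Bᵐᵒᵖ V ∧ Module.Projective Bᵐᵒᵖ V) :
    ∃ (n : ℕ) (b : Fin n → V) (φ : Fin n → V →+ Bᵐᵒᵖ),
      (∀ j c x, φ j (((1 : A) ⊗ₜ[k] c) • x) = c * φ j x) ∧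
      ∀ x, ∑ j, ((1 : A) ⊗ₜ[k] φ j x) • b j = x := by
  let := rightRestrict k A B V
  obtain ⟨_, _⟩ := h
  obtain ⟨n, b, φ, hφ⟩ := exists_dualBasis Bᵐᵒᵖ V
  exact ⟨n, b, fun j => (φ j).toAddMonoidHom, fun j c x => (φ j).map_smul c x, hφ⟩

namespace BTensor

section Contract

variable (Y) in
/-- Contraction of the left factor against a right `B`-linear form. -/
noncomputable def contractLeft (φ : X →+ Bᵐᵒᵖ)
    (hφ : ∀ c x, φ (((1 : A) ⊗ₜ[k] c) • x) = c * φ x) : BTensor k A B C X Y →+ Y :=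
  liftAdd (fun x y => (unop (φ x) ⊗ₜ[k] (1 : Cᵐᵒᵖ)) • y)
    (fun _ _ _ => by rw [map_add, unop_add, add_tmul, add_smul]) (fun _ _ _ => smul_add _ _ _)
    (fun _ _ _ => by
      rw [hφ, unop_mul, unop_op, smul_smul, Algebra.TensorProduct.tmul_mul_tmul, mul_one])

variable (X) in
/-- Contraction of the right factor against a left `B`-linear form. -/
noncomputable def contractRight (φ : Y →+ B)
    (hφ : ∀ b y, φ ((b ⊗ₜ[k] (1 : Cᵐᵒᵖ)) • y) = b * φ y) : BTensor k A B C X Y →+ X :=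
  liftAdd (fun x y => ((1 : A) ⊗ₜ[k] op (φ y)) • x)
    (fun _ _ _ => smul_add _ _ _) (fun _ _ _ => by rw [map_add, op_add, tmul_add, add_smul])
    (fun _ _ _ => by
      rw [hφ, op_mul, smul_smul, Algebra.TensorProduct.tmul_mul_tmul, one_mul])

theorem sum_mk_contractLeft {n : ℕ} {b : Fin n → X} {φ : Fin n → X →+ Bᵐᵒᵖ}
    (hφ : ∀ j c x, φ j (((1 : A) ⊗ₜ[k] c) • x) = c * φ j x)
    (h : ∀ x, ∑ j, ((1 : A) ⊗ₜ[k] φ j x) • b j = x) (z : BTensor k A B C X Y) :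
    ∑ j, mk k A B C (b j) (contractLeft Y (φ j) (hφ j) z) = z := by
  induction z using induction_on with
  | mk x y =>
    conv_rhs => rw [← h x]
    rw [mk_sum_left]
    exact Finset.sum_congr rfl fun j _ => (mk_balanced (b j) (unop (φ j x)) y).symm
  | add z z' hz hz' => simp only [map_add, mk_add_right, Finset.sum_add_distrib, hz, hz']

theorem sum_mk_contractRight {n : ℕ} {b : Fin n → Y} {φ : Fin n → Y →+ B}
    (hφ : ∀ j b y, φ j ((b ⊗ₜ[k] (1 : Cᵐᵒᵖ)) • y) = b * φ j y)
    (h : ∀ y, ∑ j, (φ j y ⊗ₜ[k] (1 : Cᵐᵒᵖ)) • b j = y) (z : BTensor k A B C X Y) :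
    ∑ j, mk k A B C (contractRight X (φ j) (hφ j) z) (b j) = z := by
  induction z using induction_on with
  | mk x y =>
    conv_rhs => rw [← h y]
    rw [mk_sum_right]
    exact Finset.sum_congr rfl fun j _ => mk_balanced x (φ j y) (b j)
  | add z z' hz hz' => simp only [map_add, mk_add_left, Finset.sum_add_distrib, hz, hz']

theorem contractLeft_map {Y' : Type} [AddCommGroup Y'] [Module k Y'] [Module (B ⊗[k] Cᵐᵒᵖ) Y']
    [IsScalarTower k (B ⊗[k] Cᵐᵒᵖ) Y'] (φ : X →+ Bᵐᵒᵖ)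
    (hφ : ∀ c x, φ (((1 : A) ⊗ₜ[k] c) • x) = c * φ x) (f : Y →ₗ[B ⊗[k] Cᵐᵒᵖ] Y')
    (z : BTensor k A B C X Y) :
    contractLeft Y' φ hφ (map LinearMap.id f z) = f (contractLeft Y φ hφ z) := by
  induction z using induction_on with
  | mk x y => exact (f.map_smul _ _).symm
  | add z z' hz hz' => simp only [map_add, hz, hz']

theorem contractRight_map {X' : Type} [AddCommGroup X'] [Module k X'] [Module (A ⊗[k] Bᵐᵒᵖ) X']
    [IsScalarTower k (A ⊗[k] Bᵐᵒᵖ) X'] (φ : Y →+ B)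
    (hφ : ∀ b y, φ ((b ⊗ₜ[k] (1 : Cᵐᵒᵖ)) • y) = b * φ y) (f : X →ₗ[A ⊗[k] Bᵐᵒᵖ] X')
    (z : BTensor k A B C X Y) :
    contractRight X' φ hφ (map (C := C) (Y := Y) f LinearMap.id z) = f (contractRight X φ hφ z) := by
  induction z using induction_on with
  | mk x y => exact (f.map_smul _ _).symm
  | add z z' hz hz' => simp only [map_add, hz, hz']

end Contract

theorem finite_projective_left
    (hX : letI := leftRestrict k A B X; Module.Finite A X ∧ Module.Projective A X)
    (hY : letI := leftRestrict k B C Y; Module.Finite B Y ∧ Module.Projective B Y) :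
    letI := leftRestrict k A C (BTensor k A B C X Y)
    Module.Finite A (BTensor k A B C X Y) ∧ Module.Projective A (BTensor k A B C X Y) := by
  obtain ⟨n, b, φ, hφ, h⟩ := exists_leftDualBasis hY
  let := leftRestrict k A B X
  let := leftRestrict k A C (BTensor k A B C X Y)
  refine finite_projective_of_sum_comp_eq hX.1 hX.2
    (fun j => { mkLeft k A B C X (b j) with
      map_smul' := fun a x => (tmul_one_smul_mk a x (b j)).symm })
    (fun j => { contractRight X (φ j) (hφ j) with map_smul' := fun a z => ?_ })
    (sum_mk_contractRight hφ h)
  change contractRight X (φ j) (hφ j) ((a ⊗ₜ[k] (1 : Cᵐᵒᵖ)) • z) =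
    (a ⊗ₜ[k] (1 : Bᵐᵒᵖ)) • contractRight X (φ j) (hφ j) z
  induction z using induction_on with
  | mk x y =>
    rw [tmul_one_smul_mk]
    exact one_tmul_smul_tmul_one_smul _ _ _
  | add z z' hz hz' => simp only [smul_add, map_add, hz, hz']

theorem finite_projective_right
    (hX : letI := rightRestrict k A B X; Module.Finite Bᵐᵒᵖ X ∧ Module.Projective Bᵐᵒᵖ X)
    (hY : letI := rightRestrict k B C Y; Module.Finite Cᵐᵒᵖ Y ∧ Module.Projective Cᵐᵒᵖ Y) :
    letI := rightRestrict k A C (BTensor k A B C X Y)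
    Module.Finite Cᵐᵒᵖ (BTensor k A B C X Y) ∧ Module.Projective Cᵐᵒᵖ (BTensor k A B C X Y) := by
  obtain ⟨n, b, φ, hφ, h⟩ := exists_rightDualBasis hX
  let := rightRestrict k B C Y
  let := rightRestrict k A C (BTensor k A B C X Y)
  refine finite_projective_of_sum_comp_eq hY.1 hY.2
    (fun j => { mkRight k A B C Y (b j) with
      map_smul' := fun c y => (one_tmul_smul_mk c (b j) y).symm })
    (fun j => { contractLeft Y (φ j) (hφ j) with map_smul' := fun c z => ?_ })
    (sum_mk_contractLeft hφ h)
  change contractLeft Y (φ j) (hφ j) (((1 : A) ⊗ₜ[k] c) • z) =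
    ((1 : B) ⊗ₜ[k] c) • contractLeft Y (φ j) (hφ j) z
  induction z using induction_on with
  | mk x y =>
    rw [one_tmul_smul_mk]
    exact (one_tmul_smul_tmul_one_smul _ _ _).symm
  | add z z' hz hz' => simp only [smul_add, map_add, hz, hz']

/-- `X ⊗_B (B ⊗ Cᵐᵒᵖ)` is finitely generated projective if `X` is so as a left module. -/
theorem finite_projective_tensor_free
    (hX : letI := leftRestrict k A B X; Module.Finite A X ∧ Module.Projective A X)
    {V : Type} [AddCommGroup V] [Module k V] [Module (B ⊗[k] Cᵐᵒᵖ) V]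
    [IsScalarTower k (B ⊗[k] Cᵐᵒᵖ) V] (e : V ≃ₗ[B ⊗[k] Cᵐᵒᵖ] B ⊗[k] Cᵐᵒᵖ) :
    Module.Finite (A ⊗[k] Cᵐᵒᵖ) (BTensor k A B C X V) ∧
      Module.Projective (A ⊗[k] Cᵐᵒᵖ) (BTensor k A B C X V) := by
  obtain ⟨n, b, φ, hφ, h⟩ := exists_leftDualBasis hX
  have hφk (j) (c : k) (x : X) : φ j (c • x) = c • φ j x := by
    rw [smul_eq_tmul_one_smul (A := A) (B := B), hφ, smul_mul_assoc, one_mul]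
  let L (j : Fin n) (x : X) : B →ₗ[k] A :=
    { toFun := fun b => φ j (((1 : A) ⊗ₜ[k] op b) • x)
      map_add' := fun _ _ => by rw [op_add, tmul_add, add_smul, map_add]
      map_smul' := fun c b => by
        rw [op_smul, tmul_smul, smul_assoc, hφk, RingHom.id_apply] }
  let s (j : Fin n) (x : X) : B ⊗[k] Cᵐᵒᵖ →ₗ[k] A ⊗[k] Cᵐᵒᵖ := (L j x).rTensor Cᵐᵒᵖ
  have hs (j x b c) : s j x (b ⊗ₜ c) = φ j (((1 : A) ⊗ₜ[k] op b) • x) ⊗ₜ[k] c := rfl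
  let σ (j : Fin n) : BTensor k A B C X (B ⊗[k] Cᵐᵒᵖ) →ₗ[A ⊗[k] Cᵐᵒᵖ] A ⊗[k] Cᵐᵒᵖ :=
    lift (fun x t => s j x t)
      (fun x x' t => by
        have : L j (x + x') = L j x + L j x' := by
          ext b
          simp [L]
        simp only [s, this, LinearMap.rTensor_add, LinearMap.add_apply])
      (fun x t t' => map_add _ _ _)
      (fun x b t => by
        induction t using TensorProduct.induction_on with
        | zero => simp
        | tmul b' c =>
          rw [smul_eq_mul, Algebra.TensorProduct.tmul_mul_tmul, hs, hs, smul_smul,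
            Algebra.TensorProduct.tmul_mul_tmul, one_mul, one_mul, op_mul]
        | add t t' ht ht' => rw [smul_add, map_add, map_add, ht, ht'])
      (fun a x t => by
        induction t using TensorProduct.induction_on with
        | zero => simp
        | tmul b' c =>
          rw [smul_eq_mul, hs, hs, Algebra.TensorProduct.tmul_mul_tmul,
            one_tmul_smul_tmul_one_smul, hφ, one_mul]
        | add t t' ht ht' => rw [map_add, map_add, smul_add, ht, ht'])
      (fun x c t => by
        induction t using TensorProduct.induction_on with
        | zero => simp
        | tmul b' c' =>
          rw [smul_eq_mul, smul_eq_mul, Algebra.TensorProduct.tmul_mul_tmul, hs, hs,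
            Algebra.TensorProduct.tmul_mul_tmul, one_mul, one_mul]
        | add t t' ht ht' => rw [smul_add, map_add, map_add, smul_add, ht, ht'])
  have hσ (j x b c) : σ j (mk k A B C x (b ⊗ₜ c)) = φ j (((1 : A) ⊗ₜ[k] op b) • x) ⊗ₜ[k] c := rfl
  suffices H : Module.Finite (A ⊗[k] Cᵐᵒᵖ) (BTensor k A B C X (B ⊗[k] Cᵐᵒᵖ)) ∧
      Module.Projective (A ⊗[k] Cᵐᵒᵖ) (BTensor k A B C X (B ⊗[k] Cᵐᵒᵖ)) by
    obtain ⟨_, _⟩ := H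
    let e' := congr (LinearEquiv.refl (A ⊗[k] Bᵐᵒᵖ) X) e.symm
    exact ⟨Module.Finite.equiv e', Module.Projective.of_equiv e'⟩
  refine finite_projective_of_sum_comp_eq (S := A ⊗[k] Cᵐᵒᵖ) (Q := A ⊗[k] Cᵐᵒᵖ)
    inferInstance inferInstance
    (fun j => LinearMap.toSpanSingleton _ _ (mk k A B C (b j) 1)) σ fun z => ?_
  simp only [LinearMap.toSpanSingleton_apply]
  induction z using induction_on with
  | mk x t =>
    induction t using TensorProduct.induction_on with
    | zero =>
      have : mk k A B C x (0 : B ⊗[k] Cᵐᵒᵖ) = 0 := map_zero (mkRight k A B C _ x)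
      rw [this]
      exact Finset.sum_eq_zero fun j _ =>
        (congrArg (· • _) (map_zero (σ j))).trans
          (zero_smul (A ⊗[k] Cᵐᵒᵖ) (mk k A B C (b j) 1))
    | tmul b' c =>
      simp only [hσ, tmul_smul_mk]
      rw [← mk_sum_left, h, mk_balanced, smul_smul, smul_eq_mul, mul_one,
        Algebra.TensorProduct.tmul_mul_tmul, mul_one, one_mul]
    | add t t' ht ht' =>
      simp only [mk_add_right, map_add, add_smul, Finset.sum_add_distrib, ht, ht']
  | add z z' hz hz' => simp only [map_add, add_smul, Finset.sum_add_distrib, hz, hz']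

/-- `(A ⊗ Bᵐᵒᵖ) ⊗_B Y` is finitely generated projective if `Y` is so as a right module. -/
theorem finite_projective_free_tensor
    (hY : letI := rightRestrict k B C Y; Module.Finite Cᵐᵒᵖ Y ∧ Module.Projective Cᵐᵒᵖ Y)
    {V : Type} [AddCommGroup V] [Module k V] [Module (A ⊗[k] Bᵐᵒᵖ) V]
    [IsScalarTower k (A ⊗[k] Bᵐᵒᵖ) V] (e : V ≃ₗ[A ⊗[k] Bᵐᵒᵖ] A ⊗[k] Bᵐᵒᵖ) :
    Module.Finite (A ⊗[k] Cᵐᵒᵖ) (BTensor k A B C V Y) ∧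
      Module.Projective (A ⊗[k] Cᵐᵒᵖ) (BTensor k A B C V Y) := by
  obtain ⟨n, b, φ, hφ, h⟩ := exists_rightDualBasis hY
  have hφk (j) (c : k) (y : Y) : φ j (c • y) = c • φ j y := by
    rw [smul_eq_one_tmul_smul (A := B) (B := C), hφ, op_smul, smul_mul_assoc, op_one, one_mul]
  let L (j : Fin n) (y : Y) : Bᵐᵒᵖ →ₗ[k] Cᵐᵒᵖ :=
    { toFun := fun b => φ j ((unop b ⊗ₜ[k] (1 : Cᵐᵒᵖ)) • y)
      map_add' := fun _ _ => by rw [unop_add, add_tmul, add_smul, map_add]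
      map_smul' := fun c b => by
        rw [unop_smul, ← smul_tmul', smul_assoc, hφk, RingHom.id_apply] }
  let s (j : Fin n) (y : Y) : A ⊗[k] Bᵐᵒᵖ →ₗ[k] A ⊗[k] Cᵐᵒᵖ := (L j y).lTensor A
  have hs (j y a b) : s j y (a ⊗ₜ b) = a ⊗ₜ[k] φ j ((unop b ⊗ₜ[k] (1 : Cᵐᵒᵖ)) • y) := rfl
  let σ (j : Fin n) : BTensor k A B C (A ⊗[k] Bᵐᵒᵖ) Y →ₗ[A ⊗[k] Cᵐᵒᵖ] A ⊗[k] Cᵐᵒᵖ :=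
    lift (fun t y => s j y t)
      (fun t t' y => map_add _ _ _)
      (fun t y y' => by
        have : L j (y + y') = L j y + L j y' := by
          ext b
          simp [L]
        simp only [s, this, LinearMap.lTensor_add, LinearMap.add_apply])
      (fun t b y => by
        induction t using TensorProduct.induction_on with
        | zero => simp
        | tmul a b' =>
          rw [smul_eq_mul, Algebra.TensorProduct.tmul_mul_tmul, hs, hs, smul_smul,
            Algebra.TensorProduct.tmul_mul_tmul, one_mul, one_mul, unop_mul, unop_op]
        | add t t' ht ht' => rw [smul_add, map_add, map_add, ht, ht'])
      (fun a t y => by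
        induction t using TensorProduct.induction_on with
        | zero => simp
        | tmul a' b' =>
          rw [smul_eq_mul, smul_eq_mul, Algebra.TensorProduct.tmul_mul_tmul, hs, hs,
            Algebra.TensorProduct.tmul_mul_tmul, one_mul, one_mul]
        | add t t' ht ht' => rw [smul_add, map_add, map_add, smul_add, ht, ht'])
      (fun t c y => by
        induction t using TensorProduct.induction_on with
        | zero => simp
        | tmul a b' =>
          rw [smul_eq_mul, hs, hs, Algebra.TensorProduct.tmul_mul_tmul,
            ← one_tmul_smul_tmul_one_smul, hφ, one_mul]
        | add t t' ht ht' => rw [map_add, map_add, smul_add, ht, ht'])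
  have hσ (j y a b) :
    σ j (mk k A B C (a ⊗ₜ b) y) = a ⊗ₜ[k] φ j ((unop b ⊗ₜ[k] (1 : Cᵐᵒᵖ)) • y) := rfl
  suffices H : Module.Finite (A ⊗[k] Cᵐᵒᵖ) (BTensor k A B C (A ⊗[k] Bᵐᵒᵖ) Y) ∧
      Module.Projective (A ⊗[k] Cᵐᵒᵖ) (BTensor k A B C (A ⊗[k] Bᵐᵒᵖ) Y) by
    obtain ⟨_, _⟩ := H
    let e' := congr e.symm (LinearEquiv.refl (B ⊗[k] Cᵐᵒᵖ) Y)
    exact ⟨Module.Finite.equiv e', Module.Projective.of_equiv e'⟩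
  refine finite_projective_of_sum_comp_eq (S := A ⊗[k] Cᵐᵒᵖ) (Q := A ⊗[k] Cᵐᵒᵖ)
    inferInstance inferInstance
    (fun j => LinearMap.toSpanSingleton _ _ (mk k A B C 1 (b j))) σ fun z => ?_
  simp only [LinearMap.toSpanSingleton_apply]
  induction z using induction_on with
  | mk t y =>
    induction t using TensorProduct.induction_on with
    | zero =>
      have : mk k A B C (0 : A ⊗[k] Bᵐᵒᵖ) y = 0 := map_zero (mkLeft k A B C _ y)
      rw [this]
      exact Finset.sum_eq_zero fun j _ =>
        (congrArg (· • _) (map_zero (σ j))).trans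
          (zero_smul (A ⊗[k] Cᵐᵒᵖ) (mk k A B C 1 (b j)))
    | tmul a b' =>
      simp only [hσ, tmul_smul_mk]
      rw [← mk_sum_right, h, ← mk_balanced, smul_smul, smul_eq_mul, mul_one,
        Algebra.TensorProduct.tmul_mul_tmul, mul_one, one_mul, op_unop]
    | add t t' ht ht' =>
      simp only [mk_add_left, map_add, add_smul, Finset.sum_add_distrib, ht, ht']
  | add z z' hz hz' => simp only [map_add, add_smul, Finset.sum_add_distrib, hz, hz']

end BTensor

end BTensorExact

section TensorExact

variable {k : Type} [Field k]
variable {A B C : Type} [Ring A] [Ring B] [Ring C] [Algebra k A] [Algebra k B] [Algebra k C]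
variable {X : Type} [AddCommGroup X] [Module k X] [Module (A ⊗[k] Bᵐᵒᵖ) X]
  [IsScalarTower k (A ⊗[k] Bᵐᵒᵖ) X]
variable {Y : Type} [AddCommGroup Y] [Module k Y] [Module (B ⊗[k] Cᵐᵒᵖ) Y]
  [IsScalarTower k (B ⊗[k] Cᵐᵒᵖ) Y]

section

variable {V : Type} [AddCommGroup V] [Module k V] [Module (B ⊗[k] Cᵐᵒᵖ) V]
  [IsScalarTower k (B ⊗[k] Cᵐᵒᵖ) V]
variable {V' : Type} [AddCommGroup V'] [Module k V'] [Module (B ⊗[k] Cᵐᵒᵖ) V']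
  [IsScalarTower k (B ⊗[k] Cᵐᵒᵖ) V']
variable {V'' : Type} [AddCommGroup V''] [Module k V''] [Module (B ⊗[k] Cᵐᵒᵖ) V'']
  [IsScalarTower k (B ⊗[k] Cᵐᵒᵖ) V'']

theorem BTensor.injective_map_id_left
    (hX : letI := rightRestrict k A B X; Module.Finite Bᵐᵒᵖ X ∧ Module.Projective Bᵐᵒᵖ X)
    {f : V →ₗ[B ⊗[k] Cᵐᵒᵖ] V'} (hf : Function.Injective f) :
    Function.Injective (BTensor.map (LinearMap.id : X →ₗ[A ⊗[k] Bᵐᵒᵖ] X) f) := by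
  obtain ⟨n, b, φ, hφ, h⟩ := exists_rightDualBasis hX
  refine (injective_iff_map_eq_zero _).2 fun z hz => ?_
  rw [← BTensor.sum_mk_contractLeft hφ h z]
  refine Finset.sum_eq_zero fun j _ => ?_
  have : f (BTensor.contractLeft V (φ j) (hφ j) z) = 0 := by
    rw [← BTensor.contractLeft_map, hz, map_zero]
  rw [(map_eq_zero_iff _ hf).1 this]
  exact map_zero (BTensor.mkRight k A B C V (b j))

theorem BTensor.exact_map_id_left
    (hX : letI := rightRestrict k A B X; Module.Finite Bᵐᵒᵖ X ∧ Module.Projective Bᵐᵒᵖ X)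
    {f : V →ₗ[B ⊗[k] Cᵐᵒᵖ] V'} {g : V' →ₗ[B ⊗[k] Cᵐᵒᵖ] V''} (hfg : Function.Exact f g) :
    Function.Exact (BTensor.map (LinearMap.id : X →ₗ[A ⊗[k] Bᵐᵒᵖ] X) f)
      (BTensor.map (LinearMap.id : X →ₗ[A ⊗[k] Bᵐᵒᵖ] X) g) := by
  obtain ⟨n, b, φ, hφ, h⟩ := exists_rightDualBasis hX
  refine fun z => ⟨fun hz => ?_, ?_⟩
  · have hj (j) : ∃ v, f v = BTensor.contractLeft V' (φ j) (hφ j) z := by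
      refine (hfg _).1 ?_
      rw [← BTensor.contractLeft_map, hz, map_zero]
    choose v hv using hj
    refine ⟨∑ j, BTensor.mk k A B C (b j) (v j), ?_⟩
    refine (map_sum (BTensor.map (LinearMap.id : X →ₗ[A ⊗[k] Bᵐᵒᵖ] X) f) _ _).trans ?_
    refine Eq.trans (Finset.sum_congr rfl fun j _ => ?_) (BTensor.sum_mk_contractLeft hφ h z)
    exact congrArg (BTensor.mk k A B C (b j)) (hv j)
  · rintro ⟨w, rfl⟩
    induction w using BTensor.induction_on with
    | mk x y =>
      exact (congrArg (BTensor.mk k A B C x) (hfg.apply_apply_eq_zero y)).trans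
        (map_zero (BTensor.mkRight k A B C V'' x))
    | add w w' hw hw' => rw [map_add, map_add, hw, hw', add_zero]

theorem BTensor.surjective_map_id_left {f : V →ₗ[B ⊗[k] Cᵐᵒᵖ] V'} (hf : Function.Surjective f) :
    Function.Surjective (BTensor.map (LinearMap.id : X →ₗ[A ⊗[k] Bᵐᵒᵖ] X) f) := by
  intro z
  induction z using BTensor.induction_on with
  | mk x y =>
    obtain ⟨y, rfl⟩ := hf y
    exact ⟨BTensor.mk k A B C x y, rfl⟩
  | add z z' hz hz' =>
    obtain ⟨w, rfl⟩ := hz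
    obtain ⟨w', rfl⟩ := hz'
    exact ⟨w + w', map_add _ _ _⟩

end

section

variable {V : Type} [AddCommGroup V] [Module k V] [Module (A ⊗[k] Bᵐᵒᵖ) V]
  [IsScalarTower k (A ⊗[k] Bᵐᵒᵖ) V]
variable {V' : Type} [AddCommGroup V'] [Module k V'] [Module (A ⊗[k] Bᵐᵒᵖ) V']
  [IsScalarTower k (A ⊗[k] Bᵐᵒᵖ) V']
variable {V'' : Type} [AddCommGroup V''] [Module k V''] [Module (A ⊗[k] Bᵐᵒᵖ) V'']
  [IsScalarTower k (A ⊗[k] Bᵐᵒᵖ) V'']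

theorem BTensor.injective_map_id_right
    (hY : letI := leftRestrict k B C Y; Module.Finite B Y ∧ Module.Projective B Y)
    {f : V →ₗ[A ⊗[k] Bᵐᵒᵖ] V'} (hf : Function.Injective f) :
    Function.Injective (BTensor.map (C := C) (Y := Y) f LinearMap.id) := by
  obtain ⟨n, b, φ, hφ, h⟩ := exists_leftDualBasis hY
  refine (injective_iff_map_eq_zero _).2 fun z hz => ?_
  rw [← BTensor.sum_mk_contractRight hφ h z]
  refine Finset.sum_eq_zero fun j _ => ?_
  have : f (BTensor.contractRight V (φ j) (hφ j) z) = 0 := by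
    rw [← BTensor.contractRight_map, hz, map_zero]
  rw [(map_eq_zero_iff _ hf).1 this]
  exact map_zero (BTensor.mkLeft k A B C V (b j))

theorem BTensor.exact_map_id_right
    (hY : letI := leftRestrict k B C Y; Module.Finite B Y ∧ Module.Projective B Y)
    {f : V →ₗ[A ⊗[k] Bᵐᵒᵖ] V'} {g : V' →ₗ[A ⊗[k] Bᵐᵒᵖ] V''} (hfg : Function.Exact f g) :
    Function.Exact (BTensor.map (C := C) (Y := Y) f LinearMap.id)
      (BTensor.map (C := C) (Y := Y) g LinearMap.id) := by
  obtain ⟨n, b, φ, hφ, h⟩ := exists_leftDualBasis hY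
  refine fun z => ⟨fun hz => ?_, ?_⟩
  · have hj (j) : ∃ v, f v = BTensor.contractRight V' (φ j) (hφ j) z := by
      refine (hfg _).1 ?_
      rw [← BTensor.contractRight_map, hz, map_zero]
    choose v hv using hj
    refine ⟨∑ j, BTensor.mk k A B C (v j) (b j), ?_⟩
    refine (map_sum (BTensor.map (C := C) (Y := Y) f LinearMap.id) _ _).trans ?_
    refine Eq.trans (Finset.sum_congr rfl fun j _ => ?_) (BTensor.sum_mk_contractRight hφ h z)
    exact congrArg (BTensor.mk k A B C · (b j)) (hv j)
  · rintro ⟨w, rfl⟩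
    induction w using BTensor.induction_on with
    | mk x y =>
      exact (congrArg (BTensor.mk k A B C · y) (hfg.apply_apply_eq_zero x)).trans
        (map_zero (BTensor.mkLeft k A B C V'' y))
    | add w w' hw hw' => rw [map_add, map_add, hw, hw', add_zero]

theorem BTensor.surjective_map_id_right {f : V →ₗ[A ⊗[k] Bᵐᵒᵖ] V'} (hf : Function.Surjective f) :
    Function.Surjective (BTensor.map (C := C) (Y := Y) f LinearMap.id) := by
  intro z
  induction z using BTensor.induction_on with
  | mk x y =>
    obtain ⟨x, rfl⟩ := hf x
    exact ⟨BTensor.mk k A B C x y, rfl⟩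
  | add z z' hz hz' =>
    obtain ⟨w, rfl⟩ := hz
    obtain ⟨w', rfl⟩ := hz'
    exact ⟨w + w', map_add _ _ _⟩

end

end TensorExact

section TensorFunctors

open CategoryTheory

variable {k : Type} [Field k]
variable {A B C : Type} [Ring A] [Ring B] [Ring C] [Algebra k A] [Algebra k B] [Algebra k C]
variable {X : Type} [AddCommGroup X] [Module k X] [Module (A ⊗[k] Bᵐᵒᵖ) X]
  [IsScalarTower k (A ⊗[k] Bᵐᵒᵖ) X]
variable {Y : Type} [AddCommGroup Y] [Module k Y] [Module (B ⊗[k] Cᵐᵒᵖ) Y]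
  [IsScalarTower k (B ⊗[k] Cᵐᵒᵖ) Y]

variable (k A B C X) in
/-- The functor `X ⊗_B -` from `(B,C)`-bimodules to `(A,C)`-bimodules. -/
noncomputable def bTensorLeft : ModuleCat.{0} (B ⊗[k] Cᵐᵒᵖ) ⥤ ModuleCat.{0} (A ⊗[k] Cᵐᵒᵖ) where
  obj V :=
    letI := modK k (B ⊗[k] Cᵐᵒᵖ) V
    haveI : IsScalarTower k (B ⊗[k] Cᵐᵒᵖ) V := towerK k (B ⊗[k] Cᵐᵒᵖ) V
    ModuleCat.of (A ⊗[k] Cᵐᵒᵖ) (BTensor k A B C X V)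
  map {V V'} f :=
    letI := modK k (B ⊗[k] Cᵐᵒᵖ) V
    haveI : IsScalarTower k (B ⊗[k] Cᵐᵒᵖ) V := towerK k (B ⊗[k] Cᵐᵒᵖ) V
    letI := modK k (B ⊗[k] Cᵐᵒᵖ) V'
    haveI : IsScalarTower k (B ⊗[k] Cᵐᵒᵖ) V' := towerK k (B ⊗[k] Cᵐᵒᵖ) V'
    ModuleCat.ofHom (BTensor.map (LinearMap.id : X →ₗ[A ⊗[k] Bᵐᵒᵖ] X) f.hom)
  map_id V := by
    let := modK k (B ⊗[k] Cᵐᵒᵖ) V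
    have : IsScalarTower k (B ⊗[k] Cᵐᵒᵖ) V := towerK k (B ⊗[k] Cᵐᵒᵖ) V
    exact ModuleCat.hom_ext (BTensor.hom_ext fun _ _ => rfl)
  map_comp {V V' V''} f g := by
    let := modK k (B ⊗[k] Cᵐᵒᵖ) V
    have : IsScalarTower k (B ⊗[k] Cᵐᵒᵖ) V := towerK k (B ⊗[k] Cᵐᵒᵖ) V
    let := modK k (B ⊗[k] Cᵐᵒᵖ) V'
    have : IsScalarTower k (B ⊗[k] Cᵐᵒᵖ) V' := towerK k (B ⊗[k] Cᵐᵒᵖ) V'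
    let := modK k (B ⊗[k] Cᵐᵒᵖ) V''
    have : IsScalarTower k (B ⊗[k] Cᵐᵒᵖ) V'' := towerK k (B ⊗[k] Cᵐᵒᵖ) V''
    exact ModuleCat.hom_ext (BTensor.hom_ext fun _ _ => rfl)

instance : (bTensorLeft k A B C X).Additive where
  map_add {V V'} f g := by
    let := modK k (B ⊗[k] Cᵐᵒᵖ) V
    have : IsScalarTower k (B ⊗[k] Cᵐᵒᵖ) V := towerK k (B ⊗[k] Cᵐᵒᵖ) V
    let := modK k (B ⊗[k] Cᵐᵒᵖ) V'
    have : IsScalarTower k (B ⊗[k] Cᵐᵒᵖ) V' := towerK k (B ⊗[k] Cᵐᵒᵖ) V'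
    exact ModuleCat.hom_ext (BTensor.hom_ext fun _ _ => BTensor.mk_add_right _ _ _)

/-- The value of `bTensorLeft` does not depend on the chosen `k`-structures. -/
noncomputable def bTensorLeftObjEquiv {V : ModuleCat.{0} (B ⊗[k] Cᵐᵒᵖ)} (e : V ≃ₗ[B ⊗[k] Cᵐᵒᵖ] Y) :
    (bTensorLeft k A B C X).obj V ≃ₗ[A ⊗[k] Cᵐᵒᵖ] BTensor k A B C X Y :=
  letI := modK k (B ⊗[k] Cᵐᵒᵖ) V
  haveI : IsScalarTower k (B ⊗[k] Cᵐᵒᵖ) V := towerK k (B ⊗[k] Cᵐᵒᵖ) V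
  BTensor.congr (LinearEquiv.refl (A ⊗[k] Bᵐᵒᵖ) X) e

theorem isExactProj_bTensorLeft
    (hl : letI := leftRestrict k A B X; Module.Finite A X ∧ Module.Projective A X)
    (hr : letI := rightRestrict k A B X; Module.Finite Bᵐᵒᵖ X ∧ Module.Projective Bᵐᵒᵖ X) :
    IsExactProj (bTensorLeft k A B C X) := by
  refine ⟨fun {V V'} f hf => ?_, fun {V V' V''} f g hfg => ?_, fun {V V'} f hf => ?_,
    fun P _ _ => ?_⟩
  · let := modK k (B ⊗[k] Cᵐᵒᵖ) V
    have : IsScalarTower k (B ⊗[k] Cᵐᵒᵖ) V := towerK k (B ⊗[k] Cᵐᵒᵖ) V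
    let := modK k (B ⊗[k] Cᵐᵒᵖ) V'
    have : IsScalarTower k (B ⊗[k] Cᵐᵒᵖ) V' := towerK k (B ⊗[k] Cᵐᵒᵖ) V'
    exact BTensor.injective_map_id_left hr hf
  · let := modK k (B ⊗[k] Cᵐᵒᵖ) V
    have : IsScalarTower k (B ⊗[k] Cᵐᵒᵖ) V := towerK k (B ⊗[k] Cᵐᵒᵖ) V
    let := modK k (B ⊗[k] Cᵐᵒᵖ) V'
    have : IsScalarTower k (B ⊗[k] Cᵐᵒᵖ) V' := towerK k (B ⊗[k] Cᵐᵒᵖ) V'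
    let := modK k (B ⊗[k] Cᵐᵒᵖ) V''
    have : IsScalarTower k (B ⊗[k] Cᵐᵒᵖ) V'' := towerK k (B ⊗[k] Cᵐᵒᵖ) V''
    exact BTensor.exact_map_id_left hr hfg
  · let := modK k (B ⊗[k] Cᵐᵒᵖ) V
    have : IsScalarTower k (B ⊗[k] Cᵐᵒᵖ) V := towerK k (B ⊗[k] Cᵐᵒᵖ) V
    let := modK k (B ⊗[k] Cᵐᵒᵖ) V'
    have : IsScalarTower k (B ⊗[k] Cᵐᵒᵖ) V' := towerK k (B ⊗[k] Cᵐᵒᵖ) V'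
    exact BTensor.surjective_map_id_left hf
  · have H (V : ModuleCat.{0} (B ⊗[k] Cᵐᵒᵖ)) (e : V ≃ₗ[B ⊗[k] Cᵐᵒᵖ] B ⊗[k] Cᵐᵒᵖ) :
        Module.Finite (A ⊗[k] Cᵐᵒᵖ) ((bTensorLeft k A B C X).obj V) ∧
          Module.Projective (A ⊗[k] Cᵐᵒᵖ) ((bTensorLeft k A B C X).obj V) := by
      let := modK k (B ⊗[k] Cᵐᵒᵖ) V
      have : IsScalarTower k (B ⊗[k] Cᵐᵒᵖ) V := towerK k (B ⊗[k] Cᵐᵒᵖ) V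
      exact BTensor.finite_projective_tensor_free (C := C) hl e
    have H' := H (ModuleCat.of (B ⊗[k] Cᵐᵒᵖ) (B ⊗[k] Cᵐᵒᵖ)) (LinearEquiv.refl (B ⊗[k] Cᵐᵒᵖ) (B ⊗[k] Cᵐᵒᵖ))
    exact Functor.finite_projective_obj (F := bTensorLeft k A B C X) H'.1 H'.2 P

variable (k A B C Y) in
/-- The functor `- ⊗_B Y` from `(A,B)`-bimodules to `(A,C)`-bimodules. -/
noncomputable def bTensorRight : ModuleCat.{0} (A ⊗[k] Bᵐᵒᵖ) ⥤ ModuleCat.{0} (A ⊗[k] Cᵐᵒᵖ) where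
  obj V :=
    letI := modK k (A ⊗[k] Bᵐᵒᵖ) V
    haveI : IsScalarTower k (A ⊗[k] Bᵐᵒᵖ) V := towerK k (A ⊗[k] Bᵐᵒᵖ) V
    ModuleCat.of (A ⊗[k] Cᵐᵒᵖ) (BTensor k A B C V Y)
  map {V V'} f :=
    letI := modK k (A ⊗[k] Bᵐᵒᵖ) V
    haveI : IsScalarTower k (A ⊗[k] Bᵐᵒᵖ) V := towerK k (A ⊗[k] Bᵐᵒᵖ) V
    letI := modK k (A ⊗[k] Bᵐᵒᵖ) V'
    haveI : IsScalarTower k (A ⊗[k] Bᵐᵒᵖ) V' := towerK k (A ⊗[k] Bᵐᵒᵖ) V'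
    ModuleCat.ofHom (BTensor.map (C := C) (Y := Y) f.hom LinearMap.id)
  map_id V := by
    let := modK k (A ⊗[k] Bᵐᵒᵖ) V
    have : IsScalarTower k (A ⊗[k] Bᵐᵒᵖ) V := towerK k (A ⊗[k] Bᵐᵒᵖ) V
    exact ModuleCat.hom_ext (BTensor.hom_ext fun _ _ => rfl)
  map_comp {V V' V''} f g := by
    let := modK k (A ⊗[k] Bᵐᵒᵖ) V
    have : IsScalarTower k (A ⊗[k] Bᵐᵒᵖ) V := towerK k (A ⊗[k] Bᵐᵒᵖ) V
    let := modK k (A ⊗[k] Bᵐᵒᵖ) V'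
    have : IsScalarTower k (A ⊗[k] Bᵐᵒᵖ) V' := towerK k (A ⊗[k] Bᵐᵒᵖ) V'
    let := modK k (A ⊗[k] Bᵐᵒᵖ) V''
    have : IsScalarTower k (A ⊗[k] Bᵐᵒᵖ) V'' := towerK k (A ⊗[k] Bᵐᵒᵖ) V''
    exact ModuleCat.hom_ext (BTensor.hom_ext fun _ _ => rfl)

instance : (bTensorRight k A B C Y).Additive where
  map_add {V V'} f g := by
    let := modK k (A ⊗[k] Bᵐᵒᵖ) V
    have : IsScalarTower k (A ⊗[k] Bᵐᵒᵖ) V := towerK k (A ⊗[k] Bᵐᵒᵖ) V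
    let := modK k (A ⊗[k] Bᵐᵒᵖ) V'
    have : IsScalarTower k (A ⊗[k] Bᵐᵒᵖ) V' := towerK k (A ⊗[k] Bᵐᵒᵖ) V'
    exact ModuleCat.hom_ext (BTensor.hom_ext fun _ _ => BTensor.mk_add_left _ _ _)

/-- The value of `bTensorRight` does not depend on the chosen `k`-structures. -/
noncomputable def bTensorRightObjEquiv {V : ModuleCat.{0} (A ⊗[k] Bᵐᵒᵖ)} (e : V ≃ₗ[A ⊗[k] Bᵐᵒᵖ] X) :
    (bTensorRight k A B C Y).obj V ≃ₗ[A ⊗[k] Cᵐᵒᵖ] BTensor k A B C X Y :=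
  letI := modK k (A ⊗[k] Bᵐᵒᵖ) V
  haveI : IsScalarTower k (A ⊗[k] Bᵐᵒᵖ) V := towerK k (A ⊗[k] Bᵐᵒᵖ) V
  BTensor.congr e (LinearEquiv.refl (B ⊗[k] Cᵐᵒᵖ) Y)

theorem isExactProj_bTensorRight
    (hl : letI := leftRestrict k B C Y; Module.Finite B Y ∧ Module.Projective B Y)
    (hr : letI := rightRestrict k B C Y; Module.Finite Cᵐᵒᵖ Y ∧ Module.Projective Cᵐᵒᵖ Y) :
    IsExactProj (bTensorRight k A B C Y) := by
  refine ⟨fun {V V'} f hf => ?_, fun {V V' V''} f g hfg => ?_, fun {V V'} f hf => ?_,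
    fun P _ _ => ?_⟩
  · let := modK k (A ⊗[k] Bᵐᵒᵖ) V
    have : IsScalarTower k (A ⊗[k] Bᵐᵒᵖ) V := towerK k (A ⊗[k] Bᵐᵒᵖ) V
    let := modK k (A ⊗[k] Bᵐᵒᵖ) V'
    have : IsScalarTower k (A ⊗[k] Bᵐᵒᵖ) V' := towerK k (A ⊗[k] Bᵐᵒᵖ) V'
    exact BTensor.injective_map_id_right hl hf
  · let := modK k (A ⊗[k] Bᵐᵒᵖ) V
    have : IsScalarTower k (A ⊗[k] Bᵐᵒᵖ) V := towerK k (A ⊗[k] Bᵐᵒᵖ) V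
    let := modK k (A ⊗[k] Bᵐᵒᵖ) V'
    have : IsScalarTower k (A ⊗[k] Bᵐᵒᵖ) V' := towerK k (A ⊗[k] Bᵐᵒᵖ) V'
    let := modK k (A ⊗[k] Bᵐᵒᵖ) V''
    have : IsScalarTower k (A ⊗[k] Bᵐᵒᵖ) V'' := towerK k (A ⊗[k] Bᵐᵒᵖ) V''
    exact BTensor.exact_map_id_right hl hfg
  · let := modK k (A ⊗[k] Bᵐᵒᵖ) V
    have : IsScalarTower k (A ⊗[k] Bᵐᵒᵖ) V := towerK k (A ⊗[k] Bᵐᵒᵖ) V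
    let := modK k (A ⊗[k] Bᵐᵒᵖ) V'
    have : IsScalarTower k (A ⊗[k] Bᵐᵒᵖ) V' := towerK k (A ⊗[k] Bᵐᵒᵖ) V'
    exact BTensor.surjective_map_id_right hf
  · have H (V : ModuleCat.{0} (A ⊗[k] Bᵐᵒᵖ)) (e : V ≃ₗ[A ⊗[k] Bᵐᵒᵖ] A ⊗[k] Bᵐᵒᵖ) :
        Module.Finite (A ⊗[k] Cᵐᵒᵖ) ((bTensorRight k A B C Y).obj V) ∧
          Module.Projective (A ⊗[k] Cᵐᵒᵖ) ((bTensorRight k A B C Y).obj V) := by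
      let := modK k (A ⊗[k] Bᵐᵒᵖ) V
      have : IsScalarTower k (A ⊗[k] Bᵐᵒᵖ) V := towerK k (A ⊗[k] Bᵐᵒᵖ) V
      exact BTensor.finite_projective_free_tensor (A := A) hr e
    have H' := H (ModuleCat.of (A ⊗[k] Bᵐᵒᵖ) (A ⊗[k] Bᵐᵒᵖ)) (LinearEquiv.refl (A ⊗[k] Bᵐᵒᵖ) (A ⊗[k] Bᵐᵒᵖ))
    exact Functor.finite_projective_obj (F := bTensorRight k A B C Y) H'.1 H'.2 P

end TensorFunctors

section Composition

open CategoryTheory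

variable {k : Type} [Field k] {Λ Γ SS : Type} [Ring Λ] [Ring Γ] [Ring SS]
  [Algebra k Λ] [Algebra k Γ] [Algebra k SS]
variable {M : Type} [AddCommGroup M] [Module k M] [Module (Λ ⊗[k] Γᵐᵒᵖ) M]
  [IsScalarTower k (Λ ⊗[k] Γᵐᵒᵖ) M]
variable {N : Type} [AddCommGroup N] [Module k N] [Module (Γ ⊗[k] Λᵐᵒᵖ) N]
  [IsScalarTower k (Γ ⊗[k] Λᵐᵒᵖ) N]
variable {X : Type} [AddCommGroup X] [Module k X] [Module (Γ ⊗[k] SSᵐᵒᵖ) X]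
  [IsScalarTower k (Γ ⊗[k] SSᵐᵒᵖ) X]
variable {Y : Type} [AddCommGroup Y] [Module k Y] [Module (SS ⊗[k] Γᵐᵒᵖ) Y]
  [IsScalarTower k (SS ⊗[k] Γᵐᵒᵖ) Y]

variable (k Λ) in
theorem regularBimodule_finite :
    letI := regularBimodule k Λ
    Module.Finite (Λ ⊗[k] Λᵐᵒᵖ) Λ := by
  let := regularBimodule k Λ
  refine ⟨⟨{1}, eq_top_iff.2 fun x _ => ?_⟩⟩
  have h : (x ⊗ₜ[k] op (1 : Λ)) • (1 : Λ) = x := by rw [regularBimodule_smul, mul_one, mul_one]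
  rw [← h]
  exact Submodule.smul_mem _ _ (Submodule.subset_span (by simp))

variable (k Λ) in
theorem isArtinianRing_enveloping [FiniteDimensional k Λ] : IsArtinianRing (Λ ⊗[k] Λᵐᵒᵖ) :=
  have : Module.Finite k Λᵐᵒᵖ := Module.Finite.equiv (MulOpposite.opLinearEquiv k)
  IsArtinianRing.of_finite k (Λ ⊗[k] Λᵐᵒᵖ)

/-- Tensoring a bimodule over `Γ` on both sides by the iterated tensor functors. -/
noncomputable def bTensorBothObjEquiv {V : Type} [AddCommGroup V] [Module k V]
    [Module (Γ ⊗[k] Γᵐᵒᵖ) V] [IsScalarTower k (Γ ⊗[k] Γᵐᵒᵖ) V] :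
    (bTensorLeft k Λ Γ Γ M ⋙ bTensorRight k Λ Γ Λ N).obj (ModuleCat.of (Γ ⊗[k] Γᵐᵒᵖ) V)
      ≃ₗ[Λ ⊗[k] Λᵐᵒᵖ] BTensor k Λ Γ Λ (BTensor k Λ Γ Γ M V) N :=
  bTensorRightObjEquiv (bTensorLeftObjEquiv (V := ModuleCat.of (Γ ⊗[k] Γᵐᵒᵖ) V)
    (LinearEquiv.refl (Γ ⊗[k] Γᵐᵒᵖ) V))

theorem exists_isNthSyzygyOf_add_stablyIso [FiniteDimensional k Λ] {l w : ℕ}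
    (hMl : letI := leftRestrict k Λ Γ M; Module.Finite Λ M ∧ Module.Projective Λ M)
    (hMr : letI := rightRestrict k Λ Γ M; Module.Finite Γᵐᵒᵖ M ∧ Module.Projective Γᵐᵒᵖ M)
    (hNl : letI := leftRestrict k Γ Λ N; Module.Finite Γ N ∧ Module.Projective Γ N)
    (hNr : letI := rightRestrict k Γ Λ N; Module.Finite Λᵐᵒᵖ N ∧ Module.Projective Λᵐᵒᵖ N)
    (hMN : letI := regularBimodule k Λ;
      ∃ Z : ModuleCat.{0} (Λ ⊗[k] Λᵐᵒᵖ),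
        IsNthSyzygyOf (Λ ⊗[k] Λᵐᵒᵖ) l Z (ModuleCat.of (Λ ⊗[k] Λᵐᵒᵖ) Λ) ∧
        StablyIso (Λ ⊗[k] Λᵐᵒᵖ) (BTensor k Λ Γ Λ M N) Z)
    (hXY : letI := regularBimodule k Γ;
      ∃ Z : ModuleCat.{0} (Γ ⊗[k] Γᵐᵒᵖ),
        IsNthSyzygyOf (Γ ⊗[k] Γᵐᵒᵖ) w Z (ModuleCat.of (Γ ⊗[k] Γᵐᵒᵖ) Γ) ∧
        StablyIso (Γ ⊗[k] Γᵐᵒᵖ) (BTensor k Γ SS Γ X Y) Z) :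
    letI := regularBimodule k Λ;
    ∃ Z : ModuleCat.{0} (Λ ⊗[k] Λᵐᵒᵖ),
      IsNthSyzygyOf (Λ ⊗[k] Λᵐᵒᵖ) (l + w) Z (ModuleCat.of (Λ ⊗[k] Λᵐᵒᵖ) Λ) ∧
      StablyIso (Λ ⊗[k] Λᵐᵒᵖ)
        (BTensor k Λ SS Λ (BTensor k Λ Γ SS M X) (BTensor k SS Γ Λ Y N)) Z := by
  let := regularBimodule k Λ
  let := regularBimodule k Γ
  have := regularBimodule_isScalarTower (k := k) (B := Γ)
  have : Module.Finite (Λ ⊗[k] Λᵐᵒᵖ) (ModuleCat.of (Λ ⊗[k] Λᵐᵒᵖ) Λ) := regularBimodule_finite k Λ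
  have := isArtinianRing_enveloping k Λ
  obtain ⟨Zl, hZl, hMN⟩ := hMN
  obtain ⟨Zw, hZw, hXY⟩ := hXY
  have := hZl.finite
  obtain ⟨U, hU, -⟩ := exists_isNthSyzygyOf Zl w
  refine ⟨U, hZl.add hU, ?_⟩
  have hF := (isExactProj_bTensorLeft (C := Γ) hMl hMr).comp
    (isExactProj_bTensorRight (A := Λ) hNl hNr)
  obtain ⟨eUnit⟩ := BTensor.nonempty_rightUnit (k := k) (A := Λ) (B := Γ) (X := M)
  have hΓ : StablyIso (Λ ⊗[k] Λᵐᵒᵖ)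
      ((bTensorLeft k Λ Γ Γ M ⋙ bTensorRight k Λ Γ Λ N).obj (ModuleCat.of (Γ ⊗[k] Γᵐᵒᵖ) Γ)) Zl :=
    (StablyIso.of_equiv (bTensorBothObjEquiv ≪≫ₗ
      BTensor.congr eUnit (LinearEquiv.refl (Γ ⊗[k] Λᵐᵒᵖ) N))).trans hMN
  have hw := IsNthProjKernelOf.stablyIso hΓ (hF.isNthProjKernelOf hZw.isNthProjKernelOf)
    hU.isNthProjKernelOf
  have hXY' := hF.stablyIso (A := ModuleCat.of (Γ ⊗[k] Γᵐᵒᵖ) (BTensor k Γ SS Γ X Y)) hXY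
  have e : BTensor k Λ SS Λ (BTensor k Λ Γ SS M X) (BTensor k SS Γ Λ Y N) ≃ₗ[Λ ⊗[k] Λᵐᵒᵖ]
      (bTensorLeft k Λ Γ Γ M ⋙ bTensorRight k Λ Γ Λ N).obj
        (ModuleCat.of (Γ ⊗[k] Γᵐᵒᵖ) (BTensor k Γ SS Γ X Y)) :=
    (BTensor.assoc k Λ SS Γ Λ (BTensor k Λ Γ SS M X) Y N).symm ≪≫ₗ
      BTensor.congr (BTensor.assoc k Λ Γ SS Γ M X Y) (LinearEquiv.refl (Γ ⊗[k] Λᵐᵒᵖ) N) ≪≫ₗ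
      bTensorBothObjEquiv.symm
  exact (StablyIso.of_equiv e).trans (hXY'.trans hw)

/-- Singular equivalences of Morita type with level compose, the levels being added. -/
theorem DefinesSingEqOfLevel.comp [FiniteDimensional k Λ] [FiniteDimensional k SS] {l w : ℕ}
    (hMN : DefinesSingEqOfLevel k Λ Γ M N l) (hXY : DefinesSingEqOfLevel k Γ SS X Y w) :
    DefinesSingEqOfLevel k Λ SS (BTensor k Λ Γ SS M X) (BTensor k SS Γ Λ Y N) (l + w) := by
  obtain ⟨hMl, hMr, hNl, hNr, hMN, hNM⟩ := hMN
  obtain ⟨hXl, hXr, hYl, hYr, hXY, hYX⟩ := hXY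
  refine ⟨BTensor.finite_projective_left hMl hXl, BTensor.finite_projective_right hMr hXr,
    BTensor.finite_projective_left hYl hNl, BTensor.finite_projective_right hYr hNr,
    exists_isNthSyzygyOf_add_stablyIso hMl hMr hNl hNr hMN hXY, ?_⟩
  rw [add_comm]
  exact exists_isNthSyzygyOf_add_stablyIso hYl hYr hXl hXr hYX hNM

end Composition

/-- composing singular equivalences of Morita type with levels `l` and `w`
gives one with level `l + w`; in particular the relation is transitive. -/
theorem statement_10 (k Λ Γ SS : Type) [Field k] [Ring Λ] [Ring Γ] [Ring SS]
    [Algebra k Λ] [Algebra k Γ] [Algebra k SS]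
    [FiniteDimensional k Λ] [FiniteDimensional k Γ] [FiniteDimensional k SS]
    (M : Type) [AddCommGroup M] [Module k M] [Module (Λ ⊗[k] Γᵐᵒᵖ) M]
    [IsScalarTower k (Λ ⊗[k] Γᵐᵒᵖ) M]
    (N : Type) [AddCommGroup N] [Module k N] [Module (Γ ⊗[k] Λᵐᵒᵖ) N]
    [IsScalarTower k (Γ ⊗[k] Λᵐᵒᵖ) N]
    (X : Type) [AddCommGroup X] [Module k X] [Module (Γ ⊗[k] SSᵐᵒᵖ) X]
    [IsScalarTower k (Γ ⊗[k] SSᵐᵒᵖ) X]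
    (Y : Type) [AddCommGroup Y] [Module k Y] [Module (SS ⊗[k] Γᵐᵒᵖ) Y]
    [IsScalarTower k (SS ⊗[k] Γᵐᵒᵖ) Y]
    (l w : ℕ)
    (hMN : DefinesSingEqOfLevel k Λ Γ M N l)
    (hXY : DefinesSingEqOfLevel k Γ SS X Y w) :
    DefinesSingEqOfLevel k Λ SS (BTensor k Λ Γ SS M X) (BTensor k SS Γ Λ Y N) (l + w) ∧
    (Nonempty (SingEqMoritaLevel k Λ Γ) → Nonempty (SingEqMoritaLevel k Γ SS) →
      Nonempty (SingEqMoritaLevel k Λ SS)) := by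
  refine ⟨hMN.comp hXY, ?_⟩
  rintro ⟨⟨M', N', l', h⟩⟩ ⟨⟨X', Y', w', h'⟩⟩
  exact ⟨⟨_, _, _, h.comp h'⟩⟩
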